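/- Let G=(V,E) be a finite simple graph and let u,v ∈ V. Then {u,v} is globally linked in G in ℝ² if and only if {u,v} is globally linked in G in ℂ². -/

import Mathlib

open scoped BigOperators

noncomputable section

namespace Rigidity

variable {V : Type*}

/-- Euclidean distance between two points of `ℝ^d` (given as coordinate functions). -/
def eDist {d : ℕ} (x y : Fin d → ℝ) : ℝ := Real.sqrt (∑ i, (x i - y i) ^ 2)

/-- Two frameworks `(G,p)` and `(G,q)` are equivalent if corresponding edge lengths agree. -/
def Equivalent {d : ℕ} (G : SimpleGraph V) (p q : V → Fin d → ℝ) : Prop :=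
  ∀ u v : V, G.Adj u v → eDist (p u) (p v) = eDist (q u) (q v)

/-- Two placements are congruent if all pairwise distances agree. -/
def Congruent {d : ℕ} (p q : V → Fin d → ℝ) : Prop :=
  ∀ u v : V, eDist (p u) (p v) = eDist (q u) (q v)

/-- A placement is generic if the multiset of its coordinates is algebraically
independent over `ℚ`. -/
def Generic {d : ℕ} (p : V → Fin d → ℝ) : Prop :=
  AlgebraicIndependent ℚ (fun vi : V × Fin d => p vi.1 vi.2)

/-- `{u,v}` is globally linked in the framework `(G,p)`. -/
def GloballyLinkedIn {d : ℕ} (G : SimpleGraph V) (p : V → Fin d → ℝ) (u v : V) : Prop :=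
  ∀ q : V → Fin d → ℝ, Equivalent G p q → eDist (q u) (q v) = eDist (p u) (p v)

/-- `{u,v}` is globally `d`-linked in `G`. -/
def GloballyLinked (d : ℕ) (G : SimpleGraph V) (u v : V) : Prop :=
  ∀ p : V → Fin d → ℝ, Generic p → GloballyLinkedIn G p u v

/-- The framework `(G,p)` is rigid. -/
def RigidFramework {d : ℕ} (G : SimpleGraph V) (p : V → Fin d → ℝ) : Prop :=
  ∃ ε > (0:ℝ), ∀ q : V → Fin d → ℝ, Equivalent G p q →
    (∀ v, eDist (p v) (q v) < ε) → Congruent p q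

/-- `G` is `d`-rigid: every generic framework of `G` in `ℝ^d` is rigid. -/
def IsRigidGraph (d : ℕ) (G : SimpleGraph V) : Prop :=
  ∀ p : V → Fin d → ℝ, Generic p → RigidFramework G p

/-- The framework `(G,p)` is globally rigid. -/
def GloballyRigidFramework {d : ℕ} (G : SimpleGraph V) (p : V → Fin d → ℝ) : Prop :=
  ∀ q : V → Fin d → ℝ, Equivalent G p q → Congruent p q

/-- The row of the rigidity matrix corresponding to the (ordered) edge `(u,v)`. -/
def edgeVec [DecidableEq V] {d : ℕ} (p : V → Fin d → ℝ) (u v : V) : V × Fin d → ℝ :=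
  fun wi => if wi.1 = u then p u wi.2 - p v wi.2
            else if wi.1 = v then p v wi.2 - p u wi.2 else 0

/-- The rank of the set of rows of the rigidity matrix of `(·,p)` indexed by `F`. -/
def rankAt [DecidableEq V] (d : ℕ) (p : V → Fin d → ℝ) (F : Set (Sym2 V)) : ℕ :=
  Module.finrank ℝ (Submodule.span ℝ
    {x : V × Fin d → ℝ | ∃ u v : V, s(u, v) ∈ F ∧ x = edgeVec p u v})

/-- `r_d(F)`: the rank of the set of rows indexed by `F` of the rigidity matrix of a
generic framework, equivalently the maximum of this rank over all placements. -/
def rd [DecidableEq V] (d : ℕ) (F : Set (Sym2 V)) : ℕ :=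
  sSup {n : ℕ | ∃ p : V → Fin d → ℝ, n = rankAt d p F}

/-- An edge set is `ℛ_d`-independent if its rank equals its cardinality. -/
def RdIndep [DecidableEq V] (d : ℕ) (F : Set (Sym2 V)) : Prop := rd d F = F.ncard

/-- An `ℛ_d`-circuit: not independent, but every proper subset is independent. -/
def RdCircuit [DecidableEq V] (d : ℕ) (C : Set (Sym2 V)) : Prop :=
  ¬ RdIndep d C ∧ ∀ C' : Set (Sym2 V), C' ⊂ C → RdIndep d C'

/-- An `ℛ_d`-circuit of the graph `G`. -/
def RdCircuitOf [DecidableEq V] (d : ℕ) (G : SimpleGraph V) (C : Set (Sym2 V)) : Prop :=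
  C ⊆ G.edgeSet ∧ RdCircuit d C

/-- `F` is (the edge set of) an `ℛ_d`-component of `G`: an equivalence class of the
relation "`e = f` or some `ℛ_d`-circuit of `G` contains both `e` and `f`". -/
def IsRdComponent [DecidableEq V] (d : ℕ) (G : SimpleGraph V) (F : Set (Sym2 V)) : Prop :=
  ∃ e ∈ G.edgeSet, F = {f | f ∈ G.edgeSet ∧
    (e = f ∨ ∃ C, RdCircuitOf d G C ∧ e ∈ C ∧ f ∈ C)}

/-- The set of vertices covered by an edge set. -/
def vertexSpan (F : Set (Sym2 V)) : Set V := {v | ∃ e ∈ F, v ∈ e}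

/-- A nonempty edge set is `ℛ_d`-connected if any two of its edges lie on a common
`ℛ_d`-circuit contained in it (or are equal). -/
def RdConnectedSet [DecidableEq V] (d : ℕ) (F : Set (Sym2 V)) : Prop :=
  F.Nonempty ∧ ∀ e ∈ F, ∀ f ∈ F, e = f ∨ ∃ C, C ⊆ F ∧ RdCircuit d C ∧ e ∈ C ∧ f ∈ C

/-- A graph (with at least one edge) is `ℛ_d`-connected. -/
def RdConnected [DecidableEq V] (d : ℕ) (H : SimpleGraph V) : Prop :=
  RdConnectedSet d H.edgeSet

/-- `e` is an `ℛ_d`-bridge of `G`: `r_d(E ∖ {e}) = r_d(E) − 1`. -/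
def IsRdBridge [DecidableEq V] (d : ℕ) (G : SimpleGraph V) (e : Sym2 V) : Prop :=
  e ∈ G.edgeSet ∧ rd d (G.edgeSet \ {e}) + 1 = rd d G.edgeSet

/-- `G + uv`. -/
def addEdge (G : SimpleGraph V) (u v : V) : SimpleGraph V :=
  G ⊔ SimpleGraph.fromEdgeSet {s(u, v)}

/-- `{u,v}` is `d`-linked in `G` if `r_d(G+uv) = r_d(G)`. -/
def IsLinked [DecidableEq V] (d : ℕ) (G : SimpleGraph V) (u v : V) : Prop :=
  rd d (addEdge G u v).edgeSet = rd d G.edgeSet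

/-- There exist `k` pairwise internally vertex-disjoint `u`–`v` paths in `H`
(i.e. `κ_H(u,v) ≥ k`). -/
def InternallyDisjointPaths (H : SimpleGraph V) (u v : V) (k : ℕ) : Prop :=
  ∃ P : Fin k → H.Walk u v, (∀ i, (P i).IsPath) ∧
    ∀ i j, i ≠ j → ∀ w, w ∈ (P i).support → w ∈ (P j).support → w = u ∨ w = v

/-- An unordered pair forming a 2-separator: two distinct vertices whose deletion
disconnects the graph. -/
def TwoSepPair (H : SimpleGraph V) (e : Sym2 V) : Prop :=
  ¬ e.IsDiag ∧ ¬ (H.induce {v | v ∉ e}).Connected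

/-- The augmented graph `Ĥ`: add an edge for every 2-separator. -/
def aug (H : SimpleGraph V) : SimpleGraph V :=
  H ⊔ SimpleGraph.fromEdgeSet {e | TwoSepPair H e}

/-- A subgraph is 3-connected: at least 4 vertices, and deleting fewer than 3
vertices leaves it connected. -/
def IsThreeConnectedSubgraph {G : SimpleGraph V} (J : G.Subgraph) : Prop :=
  4 ≤ J.verts.ncard ∧ ∀ S : Set V, S.ncard < 3 → (J.deleteVerts S).coe.Connected

/-- A 3-block of `H`: a maximal 3-connected subgraph of the augmented graph `Ĥ`. -/
def IsThreeBlock (H : SimpleGraph V) (J : (aug H).Subgraph) : Prop :=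
  IsThreeConnectedSubgraph J ∧
    ∀ J' : (aug H).Subgraph, IsThreeConnectedSubgraph J' → J ≤ J' → J = J'

/-- `h_H(e)`: the number of 3-blocks of `H` containing both vertices of `e`. -/
def numBlocksOn (H : SimpleGraph V) (e : Sym2 V) : ℕ :=
  {J : (aug H).Subgraph | IsThreeBlock H J ∧ ∀ v ∈ e, v ∈ J.verts}.ncard

open Classical in
/-- `k(H) = Σ (h_H(ab) − 1)` over all 2-separators `{a,b}` of `H`. -/
def kGraph [Fintype V] [DecidableEq V] (H : SimpleGraph V) : ℕ :=
  ∑ e : Sym2 V, if TwoSepPair H e then numBlocksOn H e - 1 else 0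

/-- The graph of an `ℛ₂`-component, on its own vertex set. -/
def componentGraph [DecidableEq V] (F : Set (Sym2 V)) :
    SimpleGraph (vertexSpan F) :=
  (SimpleGraph.fromEdgeSet F).induce (vertexSpan F)

/-- `X` is the vertex set of an `ℛ_d`-block of `G`: a 3-block of a non-trivial
`ℛ_d`-component of `G`. -/
def IsRdBlockVerts [DecidableEq V] (d : ℕ) (G : SimpleGraph V) (X : Set V) : Prop :=
  ∃ F : Set (Sym2 V), IsRdComponent d G F ∧ 2 ≤ F.ncard ∧
    ∃ J : (aug (componentGraph F)).Subgraph,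
      IsThreeBlock (componentGraph F) J ∧ X = Subtype.val '' J.verts

/-- The globally linked closure of `G` in `ℝ^d`. -/
def glc (d : ℕ) (G : SimpleGraph V) : SimpleGraph V :=
  G ⊔ SimpleGraph.fromEdgeSet {e | ∃ u v : V, e = s(u, v) ∧ GloballyLinked d G u v}

/-- A globally `d`-linked cluster: the vertex set of a maximal complete subgraph of
`glc_d(G)`. -/
def IsCluster (d : ℕ) (G : SimpleGraph V) (X : Set V) : Prop :=
  (∀ a ∈ X, ∀ b ∈ X, a ≠ b → (glc d G).Adj a b) ∧
    ∀ Y : Set V, X ⊆ Y → (∀ a ∈ Y, ∀ b ∈ Y, a ≠ b → (glc d G).Adj a b) → Y = X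

/-- Equilibrium stress of a framework, encoded as a symmetric function vanishing on
non-edges. -/
def IsEqStress [Fintype V] {d : ℕ} (G : SimpleGraph V) (p : V → Fin d → ℝ)
    (ω : V → V → ℝ) : Prop :=
  (∀ u v, ω u v = ω v u) ∧ (∀ u v, ¬ G.Adj u v → ω u v = 0) ∧
    ∀ u, ∑ v, ω u v • (p u - p v) = 0

/-- `{u,v}` is `d`-stress-linked in `G`. -/
def StressLinked [Fintype V] (d : ℕ) (G : SimpleGraph V) (u v : V) : Prop :=
  ∀ p : V → Fin d → ℝ, Generic p → ∀ q : V → Fin d → ℝ,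
    (∀ ω, IsEqStress G p ω → IsEqStress G q ω) →
    ∀ ω, IsEqStress (addEdge G u v) p ω → IsEqStress (addEdge G u v) q ω

/-- Equivalence of complex frameworks. -/
def CEquivalent {d : ℕ} (G : SimpleGraph V) (p q : V → Fin d → ℂ) : Prop :=
  ∀ u v : V, G.Adj u v →
    ∑ i, (p u i - p v i) ^ 2 = ∑ i, (q u i - q v i) ^ 2

/-- Generic complex placement. -/
def CGeneric {d : ℕ} (p : V → Fin d → ℂ) : Prop :=
  AlgebraicIndependent ℚ (fun vi : V × Fin d => p vi.1 vi.2)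

/-- `{u,v}` is globally linked in `G` in `ℂ^d`. -/
def CGloballyLinked (d : ℕ) (G : SimpleGraph V) (u v : V) : Prop :=
  ∀ p : V → Fin d → ℂ, CGeneric p → ∀ q : V → Fin d → ℂ, CEquivalent G p q →
    ∑ i, (q u i - q v i) ^ 2 = ∑ i, (p u i - p v i) ^ 2

/-- A flexing of the framework `(G,q)`. -/
def IsFlexing {d : ℕ} (G : SimpleGraph V) (q : V → Fin d → ℝ)
    (φ : Set.Icc (0:ℝ) 1 → V → Fin d → ℝ) : Prop :=
  Continuous φ ∧ φ ⟨0, Set.left_mem_Icc.mpr zero_le_one⟩ = q ∧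
    (∀ t, Equivalent G q (φ t)) ∧
    ∀ t : Set.Icc (0:ℝ) 1, 0 < (t : ℝ) → ¬ Congruent q (φ t)

/-- A finite loopless multigraph on vertex type `V` with edge type `E`. -/
structure Multigraph (V : Type*) (E : Type*) where
  ends : E → Sym2 V
  loopless : ∀ e, ¬ (ends e).IsDiag

/-- The data `(B, bar)` exhibits `G` as a body-bar graph induced by `H`. -/
def IsBodyBar {V E W : Type*} (H : Multigraph V E) (G : SimpleGraph W)
    (B : V → Set W) (bar : E → W × W) : Prop :=
  (∀ w : W, ∃! v : V, w ∈ B v) ∧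
  (∀ v : V, (B v).ncard = {e : E | v ∈ H.ends e}.ncard) ∧
  (∀ e : E, ∃ w z : V, H.ends e = s(w, z) ∧ (bar e).1 ∈ B w ∧ (bar e).2 ∈ B z) ∧
  (∀ e : E, (bar e).1 ≠ (bar e).2) ∧
  (∀ e e' : E, e ≠ e' →
    ({(bar e).1, (bar e).2} ∩ {(bar e').1, (bar e').2} : Set W) = ∅) ∧
  (∀ a b : W, G.Adj a b ↔ a ≠ b ∧
    ((∃ v : V, a ∈ B v ∧ b ∈ B v) ∨ ∃ e : E, s(a, b) = s((bar e).1, (bar e).2)))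

/-- `P` is a partition of the set `X`. -/
def IsPartitionOf {V : Type*} (X : Set V) (P : Set (Set V)) : Prop :=
  (∀ p ∈ P, p.Nonempty ∧ p ⊆ X) ∧ ∀ v ∈ X, ∃! p, p ∈ P ∧ v ∈ p

/-- The subgraph `(X,F)` of the multigraph `H` is `k`-tree-connected. -/
def SubTreeConnected {V E : Type*} (k : ℕ) (H : Multigraph V E)
    (X : Set V) (F : Set E) : Prop :=
  X.Nonempty ∧ (∀ e ∈ F, ∀ v ∈ H.ends e, v ∈ X) ∧
    ∀ P : Set (Set V), IsPartitionOf X P →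
      k * (P.ncard - 1) ≤ {e | e ∈ F ∧ ¬ ∃ p ∈ P, ∀ v ∈ H.ends e, v ∈ p}.ncard

/-- `(X,F)` is a `k`-superbrick of `H`: a maximal `k`-tree-connected subgraph. -/
def IsSuperbrick {V E : Type*} (k : ℕ) (H : Multigraph V E)
    (X : Set V) (F : Set E) : Prop :=
  SubTreeConnected k H X F ∧
    ∀ X' F', SubTreeConnected k H X' F' → X ⊆ X' → F ⊆ F' → X = X' ∧ F = F'

section

open Module Filter Topology

section Rows
variable {ι X : Type*} [Fintype ι] [DecidableEq ι] [AddCommGroup X] [Module ℝ X]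

theorem pi_surjective_of_linearIndependent {r : ι → Dual ℝ X} (h : LinearIndependent ℝ r) :
    Function.Surjective (LinearMap.pi r) := by
  rw [← LinearMap.range_eq_top]
  by_contra hne
  obtain ⟨f, hf, hle⟩ := Submodule.exists_le_ker_of_lt_top _ (lt_top_iff_ne_top.2 hne)
  apply hf
  rw [Fintype.linearIndependent_iff] at h
  have key := h (fun i => f (Pi.single i 1)) (by
    ext x
    have h1 : f (LinearMap.pi r x) = 0 := hle ⟨x, rfl⟩
    rw [LinearMap.pi_apply_eq_sum_univ f] at h1
    have hs : ∀ i : ι, (fun j => if i = j then (1 : ℝ) else 0) = Pi.single i 1 := fun i => by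
      ext j
      simp [Pi.single_apply, eq_comm]
    simpa [mul_comm, hs] using h1)
  ext i
  simpa using key i

theorem exists_dual_vectors {r : ι → Dual ℝ X} (h : LinearIndependent ℝ r) :
    ∃ z : ι → X, ∀ i j, r i (z j) = if i = j then 1 else 0 := by
  choose z hz using fun j : ι => pi_surjective_of_linearIndependent h (Pi.single j 1)
  refine ⟨z, fun i j => ?_⟩
  have := congrFun (hz j) i
  simpa [Pi.single_apply] using this

theorem linearIndependent_of_pi_surjective {r : ι → Dual ℝ X}
    (h : Function.Surjective (LinearMap.pi r)) : LinearIndependent ℝ r := by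
  rw [Fintype.linearIndependent_iff]
  intro g hg i
  obtain ⟨x, hx⟩ := h (Pi.single i 1)
  have h1 := LinearMap.congr_fun hg x
  have h2 : ∀ j, r j x = if j = i then 1 else 0 := fun j => by
    have := congrFun hx j
    simpa [Pi.single_apply] using this
  simpa [h2] using h1

theorem finrank_ker_add_card [FiniteDimensional ℝ X] {r : ι → Dual ℝ X}
    (h : LinearIndependent ℝ r) :
    finrank ℝ (LinearMap.ker (LinearMap.pi r)) + Fintype.card ι = finrank ℝ X := by
  have h1 := LinearMap.finrank_range_add_finrank_ker (LinearMap.pi r)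
  rw [LinearMap.range_eq_top.2 (pi_surjective_of_linearIndependent h), finrank_top,
    finrank_fintype_fun_eq_card] at h1
  omega

theorem linearIndependent_of_finrank_ker_le [FiniteDimensional ℝ X] {r : ι → Dual ℝ X}
    (h : finrank ℝ (LinearMap.ker (LinearMap.pi r)) + Fintype.card ι ≤ finrank ℝ X) :
    LinearIndependent ℝ r := by
  apply linearIndependent_of_pi_surjective
  rw [← LinearMap.range_eq_top]
  apply Submodule.eq_top_of_finrank_eq
  have h1 := LinearMap.finrank_range_add_finrank_ker (LinearMap.pi r)
  have h2 := Submodule.finrank_le (LinearMap.range (LinearMap.pi r))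
  rw [finrank_fintype_fun_eq_card] at *
  omega

theorem eventually_linearIndependent {r : ℝ → ι → Dual ℝ X}
    (hc : ∀ i x, ContinuousAt (fun s => r s i x) 0) (h : LinearIndependent ℝ (r 0)) :
    ∀ᶠ s in 𝓝 0, LinearIndependent ℝ (r s) := by
  obtain ⟨z, hz⟩ := exists_dual_vectors h
  have hdet : ContinuousAt (fun s => (Matrix.of fun i j => r s i (z j)).det) 0 := by
    simp only [Matrix.det_apply, Matrix.of_apply]
    refine tendsto_finsetSum _ fun σ _ => ?_
    refine Tendsto.const_smul ?_ _
    exact tendsto_finsetProd _ fun i _ => hc _ _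
  have h0 : (Matrix.of fun i j => r 0 i (z j)).det ≠ 0 := by
    have : (Matrix.of fun i j => r 0 i (z j)) = 1 := by
      ext i j
      simp [hz, Matrix.one_apply]
    simp [this]
  filter_upwards [hdet.eventually_ne h0] with s hs
  rw [Fintype.linearIndependent_iff]
  intro g hg
  have : Matrix.vecMul g (Matrix.of fun i j => r s i (z j)) = 0 := by
    ext j
    have := LinearMap.congr_fun hg (z j)
    simpa [Matrix.vecMul, dotProduct] using this
  exact fun i => congrFun (Matrix.eq_zero_of_vecMul_eq_zero hs this) i

end Rows

section Area
variable {W : Type*} [AddCommGroup W] [Module ℝ W]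

/-- The functional `y ↦ det (u, f y)` on the plane-valued vectors `W × W`. -/
def rowOf (u : ℝ × ℝ) (f : Dual ℝ W) : Dual ℝ (W × W) :=
  u.1 • (f ∘ₗ LinearMap.snd ℝ W W) - u.2 • (f ∘ₗ LinearMap.fst ℝ W W)

/-- The functional `y ↦ det (f x, f y)`. -/
def area (f : Dual ℝ W) (x : W × W) : Dual ℝ (W × W) := rowOf (f x.1, f x.2) f

/-- The squared length of `f x`. -/
def sqLen (f : Dual ℝ W) (x : W × W) : ℝ := f x.1 ^ 2 + f x.2 ^ 2

/-- Rotation by a right angle. -/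
def quarterTurn : (W × W) →ₗ[ℝ] (W × W) :=
  (-LinearMap.snd ℝ W W).prod (LinearMap.fst ℝ W W)

@[simp] theorem rowOf_apply (u : ℝ × ℝ) (f : Dual ℝ W) (y : W × W) :
    rowOf u f y = u.1 * f y.2 - u.2 * f y.1 := rfl

@[simp] theorem area_apply (f : Dual ℝ W) (x y : W × W) :
    area f x y = f x.1 * f y.2 - f x.2 * f y.1 := rfl

theorem area_swap (f : Dual ℝ W) (x y : W × W) : area f x y = -area f y x := by
  simp only [area_apply]
  ring

@[simp] theorem quarterTurn_fst (x : W × W) : (quarterTurn x).1 = -x.2 := rfl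
@[simp] theorem quarterTurn_snd (x : W × W) : (quarterTurn x).2 = x.1 := rfl

variable {ι : Type*} [DecidableEq ι]

/-- Pinning rows at `i₀`, `i₁`, and the rows `rowOf (u l) (φ l)` elsewhere. -/
def pinRows (φ : ι → Dual ℝ W) (i₀ i₁ : ι) (u : ι → ℝ × ℝ) (l : ι) : Dual ℝ (W × W) :=
  if l = i₀ then φ i₀ ∘ₗ LinearMap.fst ℝ W W
  else if l = i₁ then φ i₀ ∘ₗ LinearMap.snd ℝ W W
  else rowOf (u l) (φ l)

/-- The area rows of `χ` and `φ i₁` at `k`, and the rows `rowOf (u l) (φ l)` elsewhere. -/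
def testRows (φ : ι → Dual ℝ W) (χ : Dual ℝ W) (i₀ i₁ : ι) (u : ι → ℝ × ℝ) (k : W × W)
    (l : ι) : Dual ℝ (W × W) :=
  if l = i₀ then area χ k else if l = i₁ then area (φ i₁) k else rowOf (u l) (φ l)

/-- A direction network `u` together with a solution `k` collapsing `φ i₀`, which is unique up to
scaling and which satisfies a nondegeneracy condition involving `χ`. -/
structure IsDatum (φ : ι → Dual ℝ W) (χ : Dual ℝ W) (i₀ i₁ : ι) (u : ι → ℝ × ℝ) (k : W × W) :
    Prop where
  fst_eq : φ i₀ k.1 = 0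
  snd_eq : φ i₀ k.2 = 0
  row_eq : ∀ l, l ≠ i₀ → l ≠ i₁ → rowOf (u l) (φ l) k = 0
  pin : LinearIndependent ℝ (pinRows φ i₀ i₁ u)
  test : LinearIndependent ℝ (testRows φ χ i₀ i₁ u k)

theorem sum_eq_add_add [Fintype ι] {i₀ i₁ : ι} (h : i₀ ≠ i₁) {f : ι → ℝ}
    (hf : ∀ l, l ≠ i₀ → l ≠ i₁ → f l = 0) : ∑ l, f l = f i₀ + f i₁ := by
  rw [← Finset.sum_pair h]
  symm
  apply Finset.sum_subset (Finset.subset_univ _)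
  intro l _ hl
  simp only [Finset.mem_insert, Finset.mem_singleton, not_or] at hl
  exact hf l hl.1 hl.2

theorem exists_pair [Fintype ι] [FiniteDimensional ℝ W] {φ : ι → Dual ℝ W} {χ : Dual ℝ W}
    {p : W × W} (hcard : Fintype.card ι + 1 = 2 * finrank ℝ W)
    (hp : LinearIndependent ℝ fun i => area (φ i) p)
    (hχ : ¬ ∃ c : ι → ℝ, ∀ x y : W, χ x * χ y = ∑ i, c i * (φ i x * φ i y))
    {z : ι → W × W} (hz : ∀ i j, area (φ i) p (z j) = if i = j then 1 else 0) :
    ∃ i j, i ≠ j ∧ area χ (z j) (z i) ≠ area χ p (z i) * area (φ i) (z j) (z i)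
      + area χ p (z j) * area (φ j) (z j) (z i) := by
  by_contra hcon
  push Not at hcon
  apply hχ
  have hι : Nonempty ι := by
    rw [← Fintype.card_pos_iff]
    omega
  obtain ⟨e⟩ := hι
  have hp0 : p ≠ 0 := by
    rintro rfl
    have := hz e e
    simp at this
  set c : ι → ℝ := fun i => area χ p (z i) with hc
  -- the rows at `p` have kernel spanned by `p`
  have hker : LinearMap.ker (LinearMap.pi fun i => area (φ i) p) = Submodule.span ℝ {p} := by
    symm
    apply Submodule.eq_of_le_of_finrank_le
    · rw [Submodule.span_singleton_le_iff_mem, LinearMap.mem_ker]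
      ext i
      simp only [LinearMap.pi_apply, area_apply, Pi.zero_apply]
      ring
    · have := finrank_ker_add_card hp
      rw [finrank_prod] at this
      rw [finrank_span_singleton hp0]
      omega
  have hpar : ∀ l j, l ≠ j → ∃ t : ℝ, φ l (z j).1 = t * φ l p.1 ∧ φ l (z j).2 = t * φ l p.2 := by
    intro l j hlj
    have h1 := hz l j
    have h2 := hz l l
    simp only [area_apply, hlj, if_false, if_true] at h1 h2
    refine ⟨φ l (z j).1 * φ l (z l).2 - φ l (z j).2 * φ l (z l).1, ?_, ?_⟩
    · linear_combination (-φ l (z j).1) * h2 + φ l (z l).1 * h1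
    · linear_combination (-φ l (z j).2) * h2 + φ l (z l).2 * h1
  have hspan : ∀ B C : Dual ℝ (W × W), B p = C p → (∀ i, B (z i) = C (z i)) → B = C := by
    intro B C h1 h2
    refine LinearMap.ext fun w => ?_
    have hw : w - ∑ i, area (φ i) p w • z i ∈ Submodule.span ℝ {p} := by
      rw [← hker, LinearMap.mem_ker]
      ext j
      rw [LinearMap.pi_apply, map_sub, map_sum]
      simp only [map_smul, hz]
      simp
    obtain ⟨t, ht⟩ := Submodule.mem_span_singleton.1 hw
    rw [eq_sub_iff_add_eq] at ht
    rw [← ht]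
    simp only [map_add, map_smul, map_sum, h1, h2]
  have hrow : area χ p = ∑ i, c i • area (φ i) p := by
    apply hspan
    · simp [LinearMap.sum_apply]
      ring_nf
      simp
    · intro j
      simp only [LinearMap.sum_apply, LinearMap.smul_apply, hz]
      simp [hc]
  have hrow2 : ∀ j, area χ (z j) = ∑ i, c i • area (φ i) (z j) := by
    intro j
    apply hspan
    · have := LinearMap.congr_fun hrow (z j)
      simp only [LinearMap.sum_apply, LinearMap.smul_apply, smul_eq_mul, area_apply] at this ⊢
      rw [← neg_inj, ← Finset.sum_neg_distrib]
      convert this using 1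
      · ring
      · exact Finset.sum_congr rfl fun _ _ => by ring
    · intro i
      rw [LinearMap.sum_apply]
      by_cases hij : i = j
      · subst hij
        simp only [LinearMap.smul_apply, area_apply, smul_eq_mul]
        rw [Finset.sum_eq_zero fun l _ => by ring]
        ring
      · rw [hcon i j hij, sum_eq_add_add hij]
        · simp [hc]
        · intro l hli hlj
          obtain ⟨s, hs1, hs2⟩ := hpar l i hli
          obtain ⟨t, ht1, ht2⟩ := hpar l j hlj
          simp only [LinearMap.smul_apply, area_apply, smul_eq_mul, hs1, hs2, ht1, ht2]
          ring
  have hall : ∀ y, area χ y = ∑ i, c i • area (φ i) y := by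
    intro y
    apply hspan
    · have h := LinearMap.congr_fun hrow y
      simp only [LinearMap.sum_apply, LinearMap.smul_apply, smul_eq_mul] at h ⊢
      rw [area_swap, h, ← Finset.sum_neg_distrib]
      exact Finset.sum_congr rfl fun _ _ => by rw [area_swap _ p y]; ring
    · intro j
      have h := LinearMap.congr_fun (hrow2 j) y
      simp only [LinearMap.sum_apply, LinearMap.smul_apply, smul_eq_mul] at h ⊢
      rw [area_swap, h, ← Finset.sum_neg_distrib]
      exact Finset.sum_congr rfl fun _ _ => by rw [area_swap _ (z j) y]; ring
  refine ⟨c, fun x y => ?_⟩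
  simpa [LinearMap.sum_apply] using LinearMap.congr_fun (hall (x, 0)) (0, y)

theorem exists_isDatum [Fintype ι] [FiniteDimensional ℝ W] {φ : ι → Dual ℝ W} {χ : Dual ℝ W}
    {p : W × W} (hcard : Fintype.card ι + 1 = 2 * finrank ℝ W)
    (hp : LinearIndependent ℝ fun i => area (φ i) p)
    (hχ : ¬ ∃ c : ι → ℝ, ∀ x y : W, χ x * χ y = ∑ i, c i * (φ i x * φ i y)) :
    ∃ i₀ i₁, i₀ ≠ i₁ ∧ ∃ u k, IsDatum φ χ i₀ i₁ u k := by
  obtain ⟨z, hz⟩ := exists_dual_vectors hp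
  obtain ⟨i₀, i₁, hne, hχne⟩ := exists_pair hcard hp hχ hz
  have h00 := hz i₀ i₀
  have h01 := hz i₀ i₁
  have h10 := hz i₁ i₀
  have h11 := hz i₁ i₁
  simp only [hne, hne.symm, if_true, if_false, area_apply] at h00 h01 h10 h11
  have hself : ∀ l, area (φ l) p p = 0 := fun l => by simp only [area_apply]; ring
  set a : ℝ := area (φ i₀) (z i₁) (z i₀) with ha
  set b : ℝ := area (φ i₁) (z i₁) (z i₀) with hb
  set k : W × W := z i₁ - a • p with hk
  set k' : W × W := z i₀ + b • p with hk'
  have hk1 : φ i₀ k.1 = 0 := by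
    simp only [hk, Prod.fst_sub, Prod.smul_fst, map_sub, map_smul, smul_eq_mul, ha, area_apply]
    linear_combination (-φ i₀ (z i₁).1) * h00 + φ i₀ (z i₀).1 * h01
  have hk2 : φ i₀ k.2 = 0 := by
    simp only [hk, Prod.snd_sub, Prod.smul_snd, map_sub, map_smul, smul_eq_mul, ha, area_apply]
    linear_combination (-φ i₀ (z i₁).2) * h00 + φ i₀ (z i₀).2 * h01
  have hk'1 : φ i₁ k'.1 = 0 := by
    simp only [hk', Prod.fst_add, Prod.smul_fst, map_add, map_smul, smul_eq_mul, hb, area_apply]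
    linear_combination (-φ i₁ (z i₀).1) * h11 + φ i₁ (z i₁).1 * h10
  have hk'2 : φ i₁ k'.2 = 0 := by
    simp only [hk', Prod.snd_add, Prod.smul_snd, map_add, map_smul, smul_eq_mul, hb, area_apply]
    linear_combination (-φ i₁ (z i₀).2) * h11 + φ i₁ (z i₁).2 * h10
  have hχk : area χ k k' ≠ 0 := by
    have : area χ k k' = area χ (z i₁) (z i₀) - (area χ p (z i₀) * a + area χ p (z i₁) * b) := by
      simp only [hk, hk', area_apply, Prod.fst_sub, Prod.snd_sub,
        Prod.smul_fst, Prod.smul_snd, map_add, map_sub, map_smul, smul_eq_mul]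
      ring
    rw [this]
    exact sub_ne_zero.2 hχne
  refine ⟨i₀, i₁, hne, fun l => (φ l p.1, φ l p.2), k, hk1, hk2, ?_, ?_, ?_⟩
  · intro l h0 h1
    change area (φ l) p k = 0
    rw [hk, map_sub, map_smul, hself, hz, if_neg h1]
    simp
  · rw [Fintype.linearIndependent_iff]
    intro g hg
    have hev : ∀ x, ∑ l, g l * pinRows φ i₀ i₁ (fun l => (φ l p.1, φ l p.2)) l x = 0 := fun x => by
      simpa [LinearMap.sum_apply] using LinearMap.congr_fun hg x
    have hrest : ∀ l, l ≠ i₀ → l ≠ i₁ → ∀ x,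
        pinRows φ i₀ i₁ (fun l => (φ l p.1, φ l p.2)) l x = area (φ l) p x := by
      intro l h0 h1 x
      rw [pinRows, if_neg h0, if_neg h1]
      rfl
    have e1 := hev p
    have e2 := hev (z i₀)
    rw [sum_eq_add_add hne (fun l h0 h1 => by rw [hrest l h0 h1, hself, mul_zero])] at e1
    rw [sum_eq_add_add hne (fun l h0 h1 => by rw [hrest l h0 h1, hz, if_neg h0, mul_zero])] at e2
    simp only [pinRows, if_true, hne.symm, if_false, LinearMap.comp_apply, LinearMap.fst_apply,
      LinearMap.snd_apply] at e1 e2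
    have g0 : g i₀ = 0 := by linear_combination (-g i₀) * h00 + φ i₀ (z i₀).2 * e1 - φ i₀ p.2 * e2
    have g1 : g i₁ = 0 := by linear_combination (-g i₁) * h00 - φ i₀ (z i₀).1 * e1 + φ i₀ p.1 * e2
    intro l
    by_cases h0 : l = i₀
    · rw [h0, g0]
    by_cases h1 : l = i₁
    · rw [h1, g1]
    have e3 := hev (z l)
    rw [Finset.sum_eq_single l] at e3
    · rwa [hrest l h0 h1, hz, if_pos rfl, mul_one] at e3
    · intro j _ hj
      by_cases hj0 : j = i₀
      · rw [hj0, g0, zero_mul]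
      by_cases hj1 : j = i₁
      · rw [hj1, g1, zero_mul]
      rw [hrest j hj0 hj1, hz, if_neg hj, mul_zero]
    · simp
  · rw [Fintype.linearIndependent_iff]
    intro g hg
    have hev : ∀ x, ∑ l, g l * testRows φ χ i₀ i₁ (fun l => (φ l p.1, φ l p.2)) k l x = 0 :=
      fun x => by simpa [LinearMap.sum_apply] using LinearMap.congr_fun hg x
    have hrest : ∀ l, l ≠ i₀ → l ≠ i₁ → ∀ x,
        testRows φ χ i₀ i₁ (fun l => (φ l p.1, φ l p.2)) k l x = area (φ l) p x := by
      intro l h0 h1 x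
      rw [testRows, if_neg h0, if_neg h1]
      rfl
    have hi0 : ∀ x, testRows φ χ i₀ i₁ (fun l => (φ l p.1, φ l p.2)) k i₀ x = area χ k x := by
      intro x
      rw [testRows, if_pos rfl]
    have hi1 : ∀ x, testRows φ χ i₀ i₁ (fun l => (φ l p.1, φ l p.2)) k i₁ x
        = area (φ i₁) k x := by
      intro x
      rw [testRows, if_neg hne.symm, if_pos rfl]
    have e1 := hev k'
    have e2 := hev p
    rw [sum_eq_add_add hne (fun l h0 h1 => by
      rw [hrest l h0 h1, hk', map_add, map_smul, hself, hz, if_neg h0]; simp), hi0, hi1,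
      area_apply (φ i₁), hk'1, hk'2] at e1
    rw [sum_eq_add_add hne (fun l h0 h1 => by rw [hrest l h0 h1, hself, mul_zero]), hi0, hi1] at e2
    have g0 : g i₀ = 0 := by
      have : g i₀ * area χ k k' = 0 := by linear_combination e1
      exact (mul_eq_zero.1 this).resolve_right hχk
    have g1 : g i₁ = 0 := by
      have : area (φ i₁) k p = -1 := by
        rw [area_swap, hk, map_sub, map_smul, hself, hz, if_pos rfl]
        simp
      rw [g0, this] at e2
      linear_combination -e2
    intro l
    by_cases h0 : l = i₀
    · rw [h0, g0]
    by_cases h1 : l = i₁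
    · rw [h1, g1]
    have e3 := hev (z l)
    rw [Finset.sum_eq_single l] at e3
    · rwa [hrest l h0 h1, hz, if_pos rfl, mul_one] at e3
    · intro j _ hj
      by_cases hj0 : j = i₀
      · rw [hj0, g0, zero_mul]
      by_cases hj1 : j = i₁
      · rw [hj1, g1, zero_mul]
      rw [hrest j hj0 hj1, hz, if_neg hj, mul_zero]
    · simp

end Area

section Datum
variable {W : Type*} [AddCommGroup W] [Module ℝ W] {ι : Type*}

/-- The indices whose functional collapses at `k`. -/
def collapse (φ : ι → Dual ℝ W) (k : W × W) : Set ι := {l | φ l k.1 = 0 ∧ φ l k.2 = 0}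

/-- The vectors on which every functional in the set `C` collapses. -/
def collapseSpace (φ : ι → Dual ℝ W) (C : Set ι) : Submodule ℝ (W × W) where
  carrier := {y | ∀ l ∈ C, φ l y.1 = 0 ∧ φ l y.2 = 0}
  add_mem' := fun ha hb l hl => by simp [ha l hl, hb l hl]
  zero_mem' := fun l _ => by simp
  smul_mem' := fun c a ha l hl => by simp [ha l hl]

variable [DecidableEq ι] {φ : ι → Dual ℝ W} {χ : Dual ℝ W} {i₀ i₁ : ι} {u : ι → ℝ × ℝ} {k : W × W}

theorem IsDatum.ne_zero (D : IsDatum φ χ i₀ i₁ u k) : k ≠ 0 := by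
  rintro rfl
  apply D.test.ne_zero i₀
  rw [testRows, if_pos rfl]
  ext <;> simp

theorem IsDatum.left_mem (D : IsDatum φ χ i₀ i₁ u k) : i₀ ∈ collapse φ k :=
  ⟨D.fst_eq, D.snd_eq⟩

theorem IsDatum.right_notMem (D : IsDatum φ χ i₀ i₁ u k) (h : i₀ ≠ i₁) : i₁ ∉ collapse φ k := by
  rintro ⟨h1, h2⟩
  apply D.test.ne_zero i₁
  rw [testRows, if_neg h.symm, if_pos rfl]
  ext <;> simp [h1, h2]

theorem IsDatum.dir_ne_zero (D : IsDatum φ χ i₀ i₁ u k) {l : ι} (h0 : l ≠ i₀) (h1 : l ≠ i₁) :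
    u l ≠ 0 := by
  intro hu
  apply D.pin.ne_zero l
  rw [pinRows, if_neg h0, if_neg h1]
  ext <;> simp [hu]

variable [Fintype ι]

theorem IsDatum.mem_span [FiniteDimensional ℝ W] (D : IsDatum φ χ i₀ i₁ u k)
    (hcard : Fintype.card ι + 1 = 2 * finrank ℝ W) {y : W × W}
    (hy : y ∈ collapseSpace φ (collapse φ k))
    (hrow : ∀ l, l ∉ collapse φ k → l ≠ i₁ → rowOf (u l) (φ l) y = 0) :
    y ∈ Submodule.span ℝ {k} := by
  have hker : Submodule.span ℝ {k} = LinearMap.ker (LinearMap.pi (pinRows φ i₀ i₁ u)) := by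
    apply Submodule.eq_of_le_of_finrank_le
    · rw [Submodule.span_singleton_le_iff_mem, LinearMap.mem_ker]
      ext l
      rw [LinearMap.pi_apply, pinRows]
      split_ifs with h0 h1
      · exact D.fst_eq
      · exact D.snd_eq
      · exact D.row_eq l h0 h1
    · have := finrank_ker_add_card D.pin
      rw [finrank_prod] at this
      rw [finrank_span_singleton D.ne_zero]
      omega
  rw [hker, LinearMap.mem_ker]
  ext l
  rw [LinearMap.pi_apply, pinRows]
  split_ifs with h0 h1
  · exact (hy i₀ D.left_mem).1
  · exact (hy i₀ D.left_mem).2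
  · by_cases hl : l ∈ collapse φ k
    · have := hy l hl
      simp [this]
    · exact hrow l hl h1

theorem IsDatum.eventually (D : IsDatum φ χ i₀ i₁ u k) {f : ι} (h0 : f ≠ i₀) (h1 : f ≠ i₁)
    {y : W × W} (hy : ∀ l, pinRows φ i₀ i₁ u l y = if l = f then 1 else 0) (hne : i₀ ≠ i₁)
    (v : ℝ × ℝ) :
    ∀ᶠ δ in 𝓝 (0 : ℝ), IsDatum φ χ i₀ i₁ (Function.update u f (u f + δ • v))
      ((1 + δ * rowOf v (φ f) y) • k - (δ * rowOf v (φ f) k) • y) := by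
  have hpin : ∀ᶠ δ in 𝓝 (0 : ℝ),
      LinearIndependent ℝ (pinRows φ i₀ i₁ (Function.update u f (u f + δ • v))) := by
    apply eventually_linearIndependent
    · intro l x
      simp only [pinRows]
      split_ifs with a b
      · exact continuousAt_const
      · exact continuousAt_const
      · by_cases hl : l = f
        · subst hl
          simp only [Function.update_self, rowOf_apply, Prod.fst_add, Prod.snd_add, Prod.smul_fst,
            Prod.smul_snd, smul_eq_mul]
          fun_prop
        · simp only [Function.update_of_ne hl]
          exact continuousAt_const
    · simpa using D.pin
  have htest : ∀ᶠ δ in 𝓝 (0 : ℝ),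
      LinearIndependent ℝ (testRows φ χ i₀ i₁ (Function.update u f (u f + δ • v))
        ((1 + δ * rowOf v (φ f) y) • k - (δ * rowOf v (φ f) k) • y)) := by
    apply eventually_linearIndependent
    · intro l x
      simp only [testRows]
      split_ifs with a b
      · simp only [area_apply, Prod.fst_sub, Prod.snd_sub, Prod.smul_fst, Prod.smul_snd, map_sub,
          map_smul, smul_eq_mul]
        fun_prop
      · simp only [area_apply, Prod.fst_sub, Prod.snd_sub, Prod.smul_fst, Prod.smul_snd, map_sub,
          map_smul, smul_eq_mul]
        fun_prop
      · by_cases hl : l = f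
        · subst hl
          simp only [Function.update_self, rowOf_apply, Prod.fst_add, Prod.snd_add, Prod.smul_fst,
            Prod.smul_snd, smul_eq_mul]
          fun_prop
        · simp only [Function.update_of_ne hl]
          exact continuousAt_const
    · simpa using D.test
  have y1 : φ i₀ y.1 = 0 := by simpa [pinRows, h0.symm] using hy i₀
  have y2 : φ i₀ y.2 = 0 := by simpa [pinRows, h1.symm, hne.symm] using hy i₁
  filter_upwards [hpin, htest] with δ hδ1 hδ2
  refine ⟨?_, ?_, ?_, hδ1, hδ2⟩
  · simp [y1, D.fst_eq]
  · simp [y2, D.snd_eq]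
  · intro l a b
    have e1 := D.row_eq l a b
    have e2 := hy l
    rw [pinRows, if_neg a, if_neg b] at e2
    by_cases hl : l = f
    · subst hl
      rw [if_pos rfl] at e2
      rw [Function.update_self]
      simp only [rowOf_apply, Prod.fst_add, Prod.snd_add, Prod.smul_fst, Prod.smul_snd, map_sub,
        map_smul, smul_eq_mul] at e1 e2 ⊢
      linear_combination (1 + δ * (v.1 * φ l y.2 - v.2 * φ l y.1)) * e1
        - (δ * (v.1 * φ l k.2 - v.2 * φ l k.1)) * e2
    · rw [if_neg hl] at e2
      rw [Function.update_of_ne hl, map_sub, map_smul, map_smul, e1, e2]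
      simp

theorem IsDatum.exists_card_eq [FiniteDimensional ℝ W] (D₀ : IsDatum φ χ i₀ i₁ u k) (hne : i₀ ≠ i₁)
    (hcard : Fintype.card ι + 1 = 2 * finrank ℝ W) :
    ∃ u k, IsDatum φ χ i₀ i₁ u k ∧
      (collapse φ k)ᶜ.ncard = finrank ℝ (collapseSpace φ (collapse φ k)) := by
  classical
  have hex : ∃ n, ∃ u k, IsDatum φ χ i₀ i₁ u k ∧ (collapse φ k).ncard = n := ⟨_, u, k, D₀, rfl⟩
  obtain ⟨u, k, D, hmin⟩ := Nat.find_spec hex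
  refine ⟨u, k, D, ?_⟩
  set X := collapseSpace φ (collapse φ k) with hX
  let O : Set ι := (collapse φ k)ᶜ \ {i₁}
  have hO : O.ncard + 1 = (collapse φ k)ᶜ.ncard :=
    Set.ncard_sdiff_singleton_add_one (D.right_notMem hne)
  have hO0 : ∀ {l}, l ∈ O → l ≠ i₀ := fun hl h => hl.1 (h ▸ D.left_mem)
  have hO1 : ∀ {l}, l ∈ O → l ≠ i₁ := fun hl => hl.2
  let r : O → Dual ℝ X := fun l => (rowOf (u l) (φ l)).domRestrict X
  have hkX : k ∈ X := fun l hl => hl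
  have hr : LinearIndependent ℝ r := by
    rw [Fintype.linearIndependent_iff]
    intro t ht f
    by_contra htf
    have hev : ∀ x ∈ X, ∑ l : O, t l * rowOf (u l) (φ l) x = 0 := fun x hx => by
      simpa [LinearMap.sum_apply, r] using LinearMap.congr_fun ht ⟨x, hx⟩
    obtain ⟨z, hz⟩ := exists_dual_vectors D.pin
    set y := z f with hy
    set v : ℝ × ℝ := (-(u f).2, (u f).1) with hv
    have hcol : ∀ᶠ δ in 𝓝 (0 : ℝ), collapse φ
        ((1 + δ * rowOf v (φ f) y) • k - (δ * rowOf v (φ f) k) • y) ⊆ collapse φ k := by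
      have : ∀ l, l ∉ collapse φ k → ∀ᶠ δ in 𝓝 (0 : ℝ), l ∉ collapse φ
        ((1 + δ * rowOf v (φ f) y) • k - (δ * rowOf v (φ f) k) • y) := by
        intro l hl
        by_cases hl1 : φ l k.1 = 0
        · have hl2 : φ l k.2 ≠ 0 := fun h => hl ⟨hl1, h⟩
          have hc : ContinuousAt (fun δ : ℝ =>
              φ l ((1 + δ * rowOf v (φ f) y) • k - (δ * rowOf v (φ f) k) • y).2) 0 := by
            simp only [Prod.snd_sub, Prod.smul_snd, map_sub, map_smul, smul_eq_mul]
            fun_prop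
          filter_upwards [hc.eventually_ne (y := 0) (by simpa using hl2)] with δ hδ h
          exact hδ h.2
        · have hc : ContinuousAt (fun δ : ℝ =>
              φ l ((1 + δ * rowOf v (φ f) y) • k - (δ * rowOf v (φ f) k) • y).1) 0 := by
            simp only [Prod.fst_sub, Prod.smul_fst, map_sub, map_smul, smul_eq_mul]
            fun_prop
          filter_upwards [hc.eventually_ne (y := 0) (by simpa using hl1)] with δ hδ h
          exact hδ h.1
      have h2 : ∀ᶠ δ in 𝓝 (0 : ℝ), ∀ l, l ∉ collapse φ k → l ∉ collapse φ
        ((1 + δ * rowOf v (φ f) y) • k - (δ * rowOf v (φ f) k) • y) := by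
        rw [Filter.eventually_all]
        intro l
        by_cases hl : l ∈ collapse φ k
        · simp [hl]
        · filter_upwards [this l hl] with δ h _
          exact h
      filter_upwards [h2] with δ h l hl
      by_contra hcon
      exact h l hcon hl
    have hall := (((D.eventually (hO0 f.2) (hO1 f.2) (fun l => hz l f) hne v).and
      hcol).filter_mono (nhdsWithin_le_nhds (s := {0}ᶜ))).and
        (self_mem_nhdsWithin (a := (0 : ℝ)) (s := {0}ᶜ))
    obtain ⟨δ, ⟨D', hsub⟩, hδ⟩ := hall.exists
    set k' := (1 + δ * rowOf v (φ f) y) • k - (δ * rowOf v (φ f) k) • y with hk'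
    have hCC : collapse φ k' = collapse φ k := by
      apply Set.eq_of_subset_of_ncard_le hsub
      rw [hmin]
      exact Nat.find_min' hex ⟨_, _, D', rfl⟩
    have hk'X : k' ∈ X := by
      rw [hX, ← hCC]
      exact fun l hl => hl
    have e1 := hev k' hk'X
    rw [Finset.sum_eq_single f] at e1
    · have e2 : rowOf (u f) (φ f) k' = 0 := (mul_eq_zero.1 e1).resolve_left htf
      have e3 := D'.row_eq f (hO0 f.2) (hO1 f.2)
      rw [Function.update_self] at e3
      have hu := D.dir_ne_zero (hO0 f.2) (hO1 f.2)
      have hpos : 0 < (u f).1 ^ 2 + (u f).2 ^ 2 := by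
        by_contra hle
        apply hu
        have h1 : (u f).1 = 0 := by nlinarith [sq_nonneg (u f).1, sq_nonneg (u f).2]
        have h2 : (u f).2 = 0 := by nlinarith [sq_nonneg (u f).1, sq_nonneg (u f).2]
        exact Prod.ext h1 h2
      simp only [rowOf_apply, Prod.fst_add, Prod.snd_add, Prod.smul_fst, Prod.smul_snd,
        smul_eq_mul, hv] at e2 e3
      have e4 : (u f).2 * φ f k'.2 + (u f).1 * φ f k'.1 = 0 := by
        have : δ * ((u f).2 * φ f k'.2 + (u f).1 * φ f k'.1) = 0 := by linear_combination e2 - e3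
        exact (mul_eq_zero.1 this).resolve_left hδ
      apply f.2.1
      rw [← hCC]
      constructor
      · have : ((u f).1 ^ 2 + (u f).2 ^ 2) * φ f k'.1 = 0 := by
          linear_combination (u f).1 * e4 - (u f).2 * e2
        exact (mul_eq_zero.1 this).resolve_left hpos.ne'
      · have : ((u f).1 ^ 2 + (u f).2 ^ 2) * φ f k'.2 = 0 := by
          linear_combination (u f).2 * e4 + (u f).1 * e2
        exact (mul_eq_zero.1 this).resolve_left hpos.ne'
    · intro l _ hl
      have := D'.row_eq l (hO0 l.2) (hO1 l.2)
      rw [Function.update_of_ne (fun h => hl (Subtype.ext h))] at this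
      rw [this, mul_zero]
    · simp
  have hk1 : finrank ℝ (LinearMap.ker (LinearMap.pi r)) = 1 := by
    have hmem : (⟨k, hkX⟩ : X) ∈ LinearMap.ker (LinearMap.pi r) := by
      rw [LinearMap.mem_ker]
      ext l
      exact D.row_eq l (hO0 l.2) (hO1 l.2)
    refine finrank_eq_one (⟨⟨k, hkX⟩, hmem⟩ : LinearMap.ker (LinearMap.pi r)) ?_ ?_
    · intro h
      apply D.ne_zero
      exact congrArg (fun x : LinearMap.ker (LinearMap.pi r) => ((x : X) : W × W)) h
    · rintro ⟨⟨y, hyX⟩, hy⟩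
      rw [LinearMap.mem_ker] at hy
      have := D.mem_span hcard hyX (fun l h1 h2 => congrFun hy ⟨l, h1, h2⟩)
      obtain ⟨c, hc⟩ := Submodule.mem_span_singleton.1 this
      refine ⟨c, ?_⟩
      ext1
      ext1
      exact hc
  have h2 := finrank_ker_add_card hr
  rw [hk1, ← Nat.card_eq_fintype_card, Nat.card_coe_set_eq] at h2
  omega

end Datum

theorem eventually_affine_ne {a b : ℝ} (hb : b ≠ 0) : ∀ᶠ s in 𝓝[≠] (0 : ℝ), a + s * b ≠ 0 := by
  by_cases ha : a = 0
  · filter_upwards [self_mem_nhdsWithin] with s hs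
    rw [ha, zero_add]
    exact mul_ne_zero hs hb
  · have hc : ContinuousAt (fun s : ℝ => a + s * b) 0 := by fun_prop
    exact (hc.eventually_ne (y := 0) (by simpa using ha)).filter_mono nhdsWithin_le_nhds

theorem exists_unit_smul_eq {u w : ℝ × ℝ} (hu : u ≠ 0) (hw : w ≠ 0)
    (h : u.1 * w.2 - u.2 * w.1 = 0) : ∃ s : ℝˣ, w = (s : ℝ) • u := by
  have key : ∃ s : ℝ, w = s • u := by
    by_cases h1 : u.1 = 0
    · have h2 : u.2 ≠ 0 := fun h2 => hu (Prod.ext h1 h2)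
      refine ⟨w.2 / u.2, Prod.ext ?_ ?_⟩
      · simp only [h1, zero_mul, zero_sub, neg_eq_zero, mul_eq_zero, h2, false_or] at h
        simp [h1, h]
      · simp [h2]
    · refine ⟨w.1 / u.1, Prod.ext ?_ ?_⟩
      · simp [h1]
      · simp only [Prod.smul_snd, smul_eq_mul]
        field_simp
        linear_combination h
  obtain ⟨s, hs⟩ := key
  have : s ≠ 0 := by
    rintro rfl
    exact hw (by simpa using hs)
  exact ⟨Units.mk0 s this, hs⟩

theorem exists_mem_ne_zero_and_ne_zero {X : Type*} [AddCommGroup X] [Module ℝ X]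
    {N : Submodule ℝ X} {α β : Dual ℝ X} (h1 : ∃ n ∈ N, α n ≠ 0) (h2 : ∃ n ∈ N, β n ≠ 0) :
    ∃ n ∈ N, α n ≠ 0 ∧ β n ≠ 0 := by
  obtain ⟨a, ha, ha'⟩ := h1
  obtain ⟨b, hb, hb'⟩ := h2
  by_cases h3 : β a = 0
  · by_cases h4 : α b = 0
    · exact ⟨a + b, N.add_mem ha hb, by simp [h4, ha'], by simp [h3, hb']⟩
    · exact ⟨b, hb, h4, hb'⟩
  · exact ⟨a, ha, ha', h3⟩

section
variable {W : Type*} [AddCommGroup W] [Module ℝ W] {ι : Type*} {φ : ι → Dual ℝ W}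

theorem quarterTurn_quarterTurn (x : W × W) : quarterTurn (quarterTurn x) = -x := by
  ext <;> simp

theorem quarterTurn_mem_collapseSpace {C : Set ι} {x : W × W} (hx : x ∈ collapseSpace φ C) :
    quarterTurn x ∈ collapseSpace φ C := fun l hl => by
  simp [hx l hl]

theorem area_eq_zero_of_mem {C : Set ι} {x : W × W} (hx : x ∈ collapseSpace φ C) {l : ι}
    (hl : l ∈ C) : area (φ l) x = 0 := by
  have := hx l hl
  ext <;> simp [this]

theorem area_add (f : Dual ℝ W) (x y : W × W) : area f (x + y) = area f x + area f y := by
  refine LinearMap.ext fun z => ?_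
  simp only [area_apply, Prod.fst_add, Prod.snd_add, map_add, LinearMap.add_apply]
  ring

theorem area_smul (f : Dual ℝ W) (c : ℝ) (x : W × W) : area f (c • x) = c • area f x := by
  refine LinearMap.ext fun z => ?_
  simp only [area_apply, Prod.smul_fst, Prod.smul_snd, map_smul, LinearMap.smul_apply, smul_eq_mul]
  ring

theorem linearIndependent_area_conformal [Finite ι] {p : W × W} {c s : ℝ}
    (hcs : c ^ 2 + s ^ 2 ≠ 0) (hp : LinearIndependent ℝ fun i => area (φ i) p) :
    LinearIndependent ℝ fun i => area (φ i) (c • p + s • quarterTurn p) := by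
  classical
  have := Fintype.ofFinite ι
  obtain ⟨z, hz⟩ := exists_dual_vectors hp
  rw [Fintype.linearIndependent_iff]
  intro g hg j
  have h1 := LinearMap.congr_fun hg (c • z j + s • quarterTurn (z j))
  have h2 : ∀ i, area (φ i) (c • p + s • quarterTurn p) (c • z j + s • quarterTurn (z j))
      = (c ^ 2 + s ^ 2) * if i = j then 1 else 0 := by
    intro i
    rw [← hz]
    simp only [area_apply, Prod.fst_add, Prod.snd_add, Prod.smul_fst, Prod.smul_snd,
      quarterTurn_fst, quarterTurn_snd, map_add, map_smul, map_neg, smul_eq_mul]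
    ring
  simp only [LinearMap.sum_apply, LinearMap.smul_apply, h2] at h1
  simpa [hcs] using h1

variable [Fintype ι] [FiniteDimensional ℝ W] {χ : Dual ℝ W}

theorem exists_pair_of_card {p : W × W} (hcard : Fintype.card ι + 1 = 2 * finrank ℝ W)
    (hp : LinearIndependent ℝ fun i => area (φ i) p)
    (hχ : ¬ ∃ c : ι → ℝ, ∀ x y : W, χ x * χ y = ∑ i, c i * (φ i x * φ i y)) :
    ∃ x y : W × W, (∀ i, sqLen (φ i) x = sqLen (φ i) y) ∧ sqLen χ x ≠ sqLen χ y ∧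
      LinearIndependent ℝ fun i => area (φ i) y := by
  classical
  obtain ⟨i₀, i₁, hne, _, _, D₀⟩ := exists_isDatum hcard hp hχ
  obtain ⟨u, k, D, hcount⟩ := D₀.exists_card_eq hne hcard
  set C := collapse φ k with hC
  set X := collapseSpace φ C with hX
  have hk0 := D.ne_zero
  have hkX : k ∈ X := fun l hl => hl
  -- area rows at `k`
  have hopt : LinearIndependent ℝ
      (fun o : Option ↥Cᶜ => o.elim (area χ k) fun l => area (φ l) k) := by
    have hinj : Function.Injective (fun o : Option ↥Cᶜ => o.elim i₀ fun l => (l : ι)) := by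
      rintro (_ | a) (_ | b) h
      · rfl
      · exact absurd D.left_mem (by
          have hb : i₀ = b := h
          exact hb ▸ b.2)
      · exact absurd D.left_mem (by
          have ha : (a : ι) = i₀ := h
          exact ha ▸ a.2)
      · exact congrArg some (Subtype.ext h)
    have hbase := D.test.comp _ hinj
    have hs : ∀ o : Option ↥Cᶜ, ∃ s : ℝˣ, (o.elim (area χ k) fun l => area (φ l) k) =
        s • testRows φ χ i₀ i₁ u k (o.elim i₀ fun l => (l : ι)) := by
      rintro (_ | ⟨l, hl⟩)
      · exact ⟨1, by simp [testRows]⟩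
      · have h0 : l ≠ i₀ := fun h => hl (h ▸ D.left_mem)
        by_cases h1 : l = i₁
        · subst h1
          exact ⟨1, by simp [testRows, h0]⟩
        · obtain ⟨s, hs⟩ := exists_unit_smul_eq (D.dir_ne_zero h0 h1)
            (w := (φ l k.1, φ l k.2))
              (fun h => hl ⟨congrArg Prod.fst h, congrArg Prod.snd h⟩) (D.row_eq l h0 h1)
          refine ⟨s, ?_⟩
          simp only [Option.elim_some, testRows, h0, h1, if_false, area, hs]
          refine LinearMap.ext fun y => ?_
          rw [Units.smul_def, LinearMap.smul_apply]
          simp only [rowOf_apply, Prod.smul_fst, Prod.smul_snd, smul_eq_mul]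
          ring
    choose s hs using hs
    have := hbase.units_smul s
    convert this using 1
    ext1 o
    exact hs o
  have hrows : LinearIndependent ℝ fun l : ↥Cᶜ => area (φ l) k :=
    hopt.comp some (Option.some_injective _)
  set N := LinearMap.ker (LinearMap.pi fun l : ↥Cᶜ => area (φ l) k) with hN
  have memN : ∀ {y}, y ∈ N ↔ ∀ l, l ∉ C → area (φ l) k y = 0 := by
    intro y
    rw [hN, LinearMap.mem_ker, funext_iff, Subtype.forall]
    rfl
  have hkN : k ∈ N := memN.2 fun l _ => by simp only [area_apply]; ring
  have hNX : ∀ y ∈ N, y ∈ X → y ∈ Submodule.span ℝ {k} := by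
    intro y hy hyX
    refine D.mem_span hcard hyX fun l hl h1 => ?_
    have h0 : l ≠ i₀ := fun h => hl (h ▸ D.left_mem)
    obtain ⟨s, hs⟩ := exists_unit_smul_eq (D.dir_ne_zero h0 h1)
      (w := (φ l k.1, φ l k.2))
              (fun h => hl ⟨congrArg Prod.fst h, congrArg Prod.snd h⟩) (D.row_eq l h0 h1)
    have h2 := memN.1 hy l hl
    have hs1 : φ l k.1 = s * (u l).1 := congrArg Prod.fst hs
    have hs2 : φ l k.2 = s * (u l).2 := congrArg Prod.snd hs
    rw [area_apply, hs1, hs2] at h2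
    have h3 : (s : ℝ) * rowOf (u l) (φ l) y = 0 := by
      rw [rowOf_apply]
      linear_combination h2
    exact (mul_eq_zero.1 h3).resolve_left s.ne_zero
  have hdimN := finrank_ker_add_card hrows
  rw [← Nat.card_eq_fintype_card, Nat.card_coe_set_eq, hcount, finrank_prod, ← hN] at hdimN
  have hinf : N ⊓ X = Submodule.span ℝ {k} := by
    apply le_antisymm
    · exact fun y hy => hNX y hy.1 hy.2
    · rw [Submodule.span_singleton_le_iff_mem]
      exact ⟨hkN, hkX⟩
  have hsup := Submodule.finrank_sup_add_finrank_inf_eq N X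
  rw [hinf, finrank_span_singleton hk0] at hsup
  have hlt : N ⊔ X < ⊤ := by
    refine lt_top_iff_ne_top.2 fun h => ?_
    rw [h, finrank_top, finrank_prod] at hsup
    omega
  obtain ⟨Θ, hΘ0, hΘ⟩ := Submodule.exists_le_ker_of_lt_top _ hlt
  have hΘker : N ⊔ X = LinearMap.ker Θ := by
    apply Submodule.eq_of_le_of_finrank_le hΘ
    have := Module.Dual.finrank_ker_add_one_of_ne_zero hΘ0
    rw [finrank_prod] at this
    omega
  have hΘN : ∀ y ∈ N, Θ y = 0 := fun y hy => hΘ (Submodule.mem_sup_left hy)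
  have hΘX : ∀ y ∈ X, Θ y = 0 := fun y hy => hΘ (Submodule.mem_sup_right hy)
  -- a vector of `N` at which the rows of `C` are independent
  obtain ⟨n₀, hn₀N, hn₀⟩ : ∃ n₀ ∈ N, LinearIndependent ℝ fun l : C => area (φ l) n₀ := by
    obtain ⟨c, s, hcs, hcs'⟩ : ∃ c s : ℝ, c ^ 2 + s ^ 2 ≠ 0 ∧
        Θ (c • p + s • quarterTurn p) = 0 := by
      by_cases h : Θ p = 0
      · exact ⟨1, 0, by norm_num, by simp [h]⟩
      · refine ⟨Θ (quarterTurn p), -Θ p, ?_, ?_⟩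
        · have : 0 < Θ p ^ 2 := by positivity
          nlinarith [sq_nonneg (Θ (quarterTurn p))]
        · simp only [map_add, map_smul, smul_eq_mul]
          ring
    have hmem : c • p + s • quarterTurn p ∈ N ⊔ X := by
      rw [hΘker]
      exact hcs'
    obtain ⟨n₀, h1, x, hx, hsum⟩ := Submodule.mem_sup.1 hmem
    refine ⟨n₀, h1, ?_⟩
    have h2 := (linearIndependent_area_conformal hcs hp).comp ((↑) : C → ι)
      Subtype.val_injective
    convert h2 using 1
    ext1 l
    rw [Function.comp_apply, ← hsum, area_add, area_eq_zero_of_mem hx l.2, add_zero]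
  obtain ⟨v, hvN, hv1, hv2⟩ : ∃ v ∈ N, area χ k v ≠ 0 ∧ (Θ ∘ₗ quarterTurn) v ≠ 0 := by
    apply exists_mem_ne_zero_and_ne_zero
    · obtain ⟨z, hz⟩ := exists_dual_vectors hopt
      refine ⟨z none, memN.2 fun l hl => ?_, ?_⟩
      · simpa using hz (some ⟨l, hl⟩) none
      · have := hz none none
        simp only [Option.elim_none, if_true] at this
        rw [this]
        exact one_ne_zero
    · by_contra hcon
      push Not at hcon
      apply hΘ0
      have hJ : ∀ y ∈ LinearMap.ker Θ, Θ (quarterTurn y) = 0 := by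
        intro y hy
        rw [← hΘker] at hy
        obtain ⟨a, ha, b, hb, rfl⟩ := Submodule.mem_sup.1 hy
        rw [map_add, map_add, hΘX _ (quarterTurn_mem_collapseSpace hb), add_zero]
        exact hcon a ha
      refine LinearMap.ext fun z => ?_
      have h1 := hJ (Θ z • quarterTurn z - Θ (quarterTurn z) • z) (by
        rw [LinearMap.mem_ker, map_sub, map_smul, map_smul, smul_eq_mul, smul_eq_mul]
        ring)
      rw [map_sub, map_smul, map_smul, quarterTurn_quarterTurn, map_sub, map_smul, map_smul,
        map_neg, smul_eq_mul, smul_eq_mul] at h1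
      rw [LinearMap.zero_apply]
      nlinarith [sq_nonneg (Θ z), sq_nonneg (Θ (quarterTurn z))]
  obtain ⟨n, hnN, hn1, hn2, hn⟩ : ∃ n ∈ N, area χ k n ≠ 0 ∧ Θ (quarterTurn n) ≠ 0 ∧
      LinearIndependent ℝ fun l : C => area (φ l) n := by
    have h3 : ∀ᶠ s in 𝓝 (0 : ℝ), LinearIndependent ℝ fun l : C => area (φ l) (n₀ + s • v) := by
      apply eventually_linearIndependent (r := fun s (l : C) => area (φ l) (n₀ + s • v))
      · intro l x
        simp only [area_apply, Prod.fst_add, Prod.snd_add, Prod.smul_fst, Prod.smul_snd, map_add,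
          map_smul, smul_eq_mul]
        fun_prop
      · simpa using hn₀
    obtain ⟨s, ⟨h1, h2⟩, h3⟩ := (((eventually_affine_ne (a := area χ k n₀) hv1).and
      (eventually_affine_ne (a := Θ (quarterTurn n₀)) hv2)).and
      (h3.filter_mono nhdsWithin_le_nhds)).exists
    refine ⟨n₀ + s • v, N.add_mem hn₀N (N.smul_mem _ hvN), ?_, ?_, h3⟩
    · rwa [map_add, map_smul, smul_eq_mul]
    · rwa [map_add, map_smul, map_add, map_smul, smul_eq_mul]
  have hnX : n ∉ X := fun h =>
    hn.ne_zero ⟨i₀, D.left_mem⟩ (area_eq_zero_of_mem h D.left_mem)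
  have hkerC : ∀ y, (∀ l ∈ C, area (φ l) n y = 0) → y ∈ Submodule.span ℝ {n} ⊔ X := by
    have hn0 : n ≠ 0 := fun h => hnX (h ▸ X.zero_mem)
    have h1 : Submodule.span ℝ {n} ⊔ X ≤
        LinearMap.ker (LinearMap.pi fun l : C => area (φ l) n) := by
      refine sup_le ?_ fun y hy => ?_
      · rw [Submodule.span_singleton_le_iff_mem, LinearMap.mem_ker]
        ext l
        simp only [LinearMap.pi_apply, area_apply, Pi.zero_apply]
        ring
      · rw [LinearMap.mem_ker]
        ext l
        rw [LinearMap.pi_apply, area_swap, area_eq_zero_of_mem hy l.2]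
        simp
    have h2 := finrank_ker_add_card hn
    rw [← Nat.card_eq_fintype_card, Nat.card_coe_set_eq, finrank_prod] at h2
    have h3 := Set.ncard_add_ncard_compl C
    rw [Nat.card_eq_fintype_card] at h3
    have h4 := Submodule.finrank_sup_add_finrank_inf_eq (Submodule.span ℝ {n}) X
    have h5 : Submodule.span ℝ {n} ⊓ X = ⊥ := by
      rw [inf_comm, ← disjoint_iff]
      exact (Submodule.disjoint_span_singleton' hn0).2 hnX
    rw [h5, finrank_bot, finrank_span_singleton hn0] at h4
    have h6 := Submodule.eq_of_le_of_finrank_le h1 (by omega)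
    intro y hy
    rw [h6, LinearMap.mem_ker]
    ext l
    exact hy l l.2
  -- the limiting rows
  let g : ℝ → ι → Dual ℝ (W × W) := fun s l =>
    if l ∈ C then area (φ l) (quarterTurn n) else area (φ l) (k + s • quarterTurn n)
  have hg0 : LinearIndependent ℝ (g 0) := by
    apply linearIndependent_of_finrank_ker_le
    have hle : LinearMap.ker (LinearMap.pi (g 0)) ≤ Submodule.span ℝ {k} := by
      intro y hy
      rw [LinearMap.mem_ker] at hy
      have hy1 : ∀ l ∈ C, area (φ l) (quarterTurn n) y = 0 := fun l hl => by
        simpa [g, hl] using congrFun hy l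
      have hy2 : y ∈ N := memN.2 fun l hl => by
        simpa [g, hl] using congrFun hy l
      have hy3 := hkerC (quarterTurn y) fun l hl => by
        have := hy1 l hl
        simp only [area_apply, quarterTurn_fst, quarterTurn_snd, map_neg] at this ⊢
        linear_combination -this
      obtain ⟨a, ha, x, hx, hax⟩ := Submodule.mem_sup.1 hy3
      obtain ⟨t, rfl⟩ := Submodule.mem_span_singleton.1 ha
      have hJx := quarterTurn_mem_collapseSpace hx
      have h5 := congrArg quarterTurn hax
      rw [quarterTurn_quarterTurn, map_add, map_smul] at h5
      have h6 := congrArg Θ h5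
      rw [map_add, map_smul, map_neg, hΘX _ hJx, hΘN _ hy2, smul_eq_mul, add_zero, neg_zero] at h6
      have ht : t = 0 := (mul_eq_zero.1 h6).resolve_right hn2
      rw [ht, zero_smul, zero_add] at h5
      refine hNX y hy2 ?_
      rw [← neg_neg y, ← h5]
      exact X.neg_mem hJx
    have := Submodule.finrank_mono hle
    rw [finrank_span_singleton hk0] at this
    rw [finrank_prod]
    omega
  have hgev : ∀ᶠ s in 𝓝 (0 : ℝ), LinearIndependent ℝ (g s) := by
    apply eventually_linearIndependent _ hg0
    intro l x
    by_cases hl : l ∈ C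
    · simp only [g, hl, if_true]
      exact continuousAt_const
    · simp only [g, hl, if_false, area_apply, Prod.fst_add, Prod.snd_add, Prod.smul_fst,
        Prod.smul_snd, map_add, map_smul, smul_eq_mul]
      fun_prop
  obtain ⟨s, hgs, hs⟩ := ((hgev.filter_mono (nhdsWithin_le_nhds (s := {0}ᶜ))).and
    (self_mem_nhdsWithin (a := (0 : ℝ)) (s := {0}ᶜ))).exists
  have hlen : ∀ f : Dual ℝ W, sqLen f (k - s • quarterTurn n) - sqLen f (k + s • quarterTurn n)
      = 4 * s * area f k n := by
    intro f
    simp only [sqLen, area_apply, Prod.fst_add, Prod.snd_add, Prod.fst_sub, Prod.snd_sub,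
      Prod.smul_fst, Prod.smul_snd, quarterTurn_fst, quarterTurn_snd, map_add, map_sub, map_smul,
      map_neg, smul_eq_mul]
    ring
  refine ⟨k - s • quarterTurn n, k + s • quarterTurn n, fun l => ?_, ?_, ?_⟩
  · rw [← sub_eq_zero, hlen]
    by_cases hl : l ∈ C
    · rw [area_eq_zero_of_mem hkX hl]
      simp
    · rw [memN.1 hnN l hl, mul_zero]
  · rw [← sub_ne_zero, hlen]
    exact mul_ne_zero (mul_ne_zero four_ne_zero hs) hn1
  · have h := hgs.units_smul (fun l => if l ∈ C then Units.mk0 s hs else 1)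
    convert h using 1
    ext1 l
    rw [Pi.smul_apply', Units.smul_def]
    by_cases hl : l ∈ C
    · simp only [g, hl, if_true]
      rw [area_add, area_eq_zero_of_mem hkX hl, zero_add, area_smul]
      rfl
    · simp [g, hl]

end

section
variable {W : Type*} [AddCommGroup W] [Module ℝ W]

theorem exists_area_ne_zero {p y : W × W} (hp : LinearIndependent ℝ ![p.1, p.2])
    (hy : y ∉ Submodule.span ℝ {p}) : ∃ ψ : Dual ℝ W, area ψ p y ≠ 0 := by
  by_contra hcon
  push Not at hcon
  apply hy
  obtain ⟨e, he⟩ : ∃ e : Fin 2 → Dual ℝ W, ∀ i j, e i (![p.1, p.2] j) = if i = j then 1 else 0 := by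
    obtain ⟨g, hg⟩ := LinearMap.exists_leftInverse_of_injective
      (Finsupp.linearCombination ℝ ![p.1, p.2]) (LinearMap.ker_eq_bot.2 hp)
    refine ⟨fun i => Finsupp.lapply i ∘ₗ g, fun i j => ?_⟩
    have h := LinearMap.congr_fun hg (Finsupp.single j 1)
    rw [LinearMap.comp_apply, Finsupp.linearCombination_single, one_smul] at h
    rw [LinearMap.comp_apply, h]
    simp [Finsupp.single_apply, eq_comm]
  have h00 : e 0 p.1 = 1 := by simpa using he 0 0
  have h01 : e 0 p.2 = 0 := by simpa using he 0 1
  have h10 : e 1 p.1 = 0 := by simpa using he 1 0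
  have h11 : e 1 p.2 = 1 := by simpa using he 1 1
  have hpol : ∀ a b : Dual ℝ W, a p.1 * b y.2 - a p.2 * b y.1 + (b p.1 * a y.2 - b p.2 * a y.1)
      = 0 := by
    intro a b
    have h1 := hcon (a + b)
    have h2 := hcon a
    have h3 := hcon b
    simp only [area_apply, LinearMap.add_apply] at h1 h2 h3
    linear_combination h1 - h2 - h3
  have s1 : e 0 y.2 = 0 := by
    have := hpol (e 0) (e 0)
    rw [h00, h01] at this
    linarith
  have s2 : e 1 y.1 = 0 := by
    have := hpol (e 1) (e 1)
    rw [h10, h11] at this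
    linarith
  have s3 : e 1 y.2 = e 0 y.1 := by
    have := hpol (e 0) (e 1)
    rw [h00, h01, h10, h11] at this
    linarith
  have y2 : y.2 = e 0 y.1 • p.2 := by
    rw [← sub_eq_zero, ← Module.forall_dual_apply_eq_zero_iff ℝ]
    intro ψ
    have := hpol (e 0) ψ
    rw [h00, h01, s1] at this
    rw [map_sub, map_smul, smul_eq_mul]
    linear_combination this
  have y1 : y.1 = e 0 y.1 • p.1 := by
    rw [← sub_eq_zero, ← Module.forall_dual_apply_eq_zero_iff ℝ]
    intro ψ
    have := hpol (e 1) ψ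
    rw [h10, h11, s2, s3] at this
    rw [map_sub, map_smul, smul_eq_mul]
    linear_combination -this
  exact Submodule.mem_span_singleton.2 ⟨e 0 y.1, Prod.ext y1.symm y2.symm⟩

theorem exists_pair_of_notMem_span {ι : Type*} [Fintype ι] {φ : ι → Dual ℝ W} {χ : Dual ℝ W}
    {p : W × W} (hp : LinearIndependent ℝ fun i => area (φ i) p)
    (hχ : area χ p ∉ Submodule.span ℝ (Set.range fun i => area (φ i) p)) :
    ∃ x y : W × W, (∀ i, sqLen (φ i) x = sqLen (φ i) y) ∧ sqLen χ x ≠ sqLen χ y ∧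
      LinearIndependent ℝ fun i => area (φ i) y := by
  classical
  have hopt : LinearIndependent ℝ
      (fun o : Option ι => o.elim (area χ p) fun l => area (φ l) p) :=
    linearIndependent_option.2 ⟨hp, hχ⟩
  obtain ⟨z, hz⟩ := exists_dual_vectors hopt
  set w := quarterTurn (z none) with hw
  have hz0 : area χ p (z none) = 1 := by simpa using hz none none
  have hz1 : ∀ i, area (φ i) p (z none) = 0 := fun i => by simpa using hz (some i) none
  have hlen : ∀ (f : Dual ℝ W) (t : ℝ), sqLen f (p - t • w) - sqLen f (p + t • w)
      = 4 * t * area f p (z none) := by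
    intro f t
    simp only [sqLen, area_apply, hw, Prod.fst_add, Prod.snd_add, Prod.fst_sub, Prod.snd_sub,
      Prod.smul_fst, Prod.smul_snd, quarterTurn_fst, quarterTurn_snd, map_add, map_sub, map_smul,
      map_neg, smul_eq_mul]
    ring
  have hev : ∀ᶠ t in 𝓝 (0 : ℝ), LinearIndependent ℝ fun i => area (φ i) (p + t • w) := by
    apply eventually_linearIndependent (r := fun t i => area (φ i) (p + t • w))
    · intro l x
      simp only [area_apply, Prod.fst_add, Prod.snd_add, Prod.smul_fst, Prod.smul_snd, map_add,
        map_smul, smul_eq_mul]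
      fun_prop
    · simpa using hp
  obtain ⟨t, h, ht⟩ := ((hev.filter_mono (nhdsWithin_le_nhds (s := {0}ᶜ))).and
    (self_mem_nhdsWithin (a := (0 : ℝ)) (s := {0}ᶜ))).exists
  refine ⟨p - t • w, p + t • w, fun i => ?_, ?_, h⟩
  · rw [← sub_eq_zero, hlen, hz1, mul_zero]
  · rw [← sub_ne_zero, hlen, hz0, mul_one]
    exact mul_ne_zero four_ne_zero ht

theorem exists_pair_of_le [FiniteDimensional ℝ W] (n : ℕ) :
    ∀ {ι : Type*} [Fintype ι] {φ : ι → Dual ℝ W} {χ : Dual ℝ W}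
    {p : W × W}, Fintype.card ι + 1 + n = 2 * finrank ℝ W →
    LinearIndependent ℝ ![p.1, p.2] →
    (LinearIndependent ℝ fun i => area (φ i) p) →
    (¬ ∃ c : ι → ℝ, ∀ x y : W, χ x * χ y = ∑ i, c i * (φ i x * φ i y)) →
    ∃ x y : W × W, (∀ i, sqLen (φ i) x = sqLen (φ i) y) ∧ sqLen χ x ≠ sqLen χ y ∧
      LinearIndependent ℝ fun i => area (φ i) y := by
  classical
  induction n with
  | zero => exact fun hcard _ hp hχ => exists_pair_of_card hcard hp hχ
  | succ n ih =>
    intro ι _ φ χ p hcard hpp hp hχ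
    by_cases hmem : area χ p ∈ Submodule.span ℝ (Set.range fun i => area (φ i) p)
    swap
    · exact exists_pair_of_notMem_span hp hmem
    obtain ⟨y, hy, hyp⟩ : ∃ y, (∀ i, area (φ i) p y = 0) ∧ y ∉ Submodule.span ℝ {p} := by
      by_contra hcon
      push Not at hcon
      have hle : LinearMap.ker (LinearMap.pi fun i => area (φ i) p) ≤ Submodule.span ℝ {p} :=
        fun y hy => hcon y fun i => congrFun (LinearMap.mem_ker.1 hy) i
      have h1 := Submodule.finrank_mono hle
      have h2 := finrank_span_le_card (R := ℝ) ({p} : Set (W × W))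
      have h3 := finrank_ker_add_card hp
      rw [finrank_prod] at h3
      simp only [Set.toFinset_singleton, Finset.card_singleton] at h2
      omega
    obtain ⟨ψ, hψ⟩ := exists_area_ne_zero hpp hyp
    have hy' : ∀ f ∈ Submodule.span ℝ (Set.range fun i => area (φ i) p), f y = 0 := by
      intro f hf
      induction hf using Submodule.span_induction with
      | mem f hf => obtain ⟨i, rfl⟩ := hf; exact hy i
      | zero => rfl
      | add f g _ _ h1 h2 => rw [LinearMap.add_apply, h1, h2, add_zero]
      | smul c f _ h => rw [LinearMap.smul_apply, h, smul_zero]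
    have hopt : LinearIndependent ℝ fun o : Option ι => area (o.elim ψ φ) p := by
      exact linearIndependent_option.2 ⟨hp, fun h => hψ (hy' _ h)⟩
    obtain ⟨a, b, h1, h2, h3⟩ := ih (φ := fun o : Option ι => o.elim ψ φ) (χ := χ)
      (by rw [Fintype.card_option]; omega) hpp hopt (by
        rintro ⟨c, hc⟩
        simp only [Fintype.sum_option, Option.elim_none, Option.elim_some] at hc
        have harea : area χ p y = c none * area ψ p y + ∑ i, c (some i) * area (φ i) p y := by
          simp only [area_apply, mul_sub, Finset.sum_sub_distrib]
          rw [hc p.1 y.2, hc p.2 y.1]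
          ring
        rw [hy' _ hmem] at harea
        simp only [hy, mul_zero, Finset.sum_const_zero, add_zero] at harea
        have h0 : c none = 0 := (mul_eq_zero.1 harea.symm).resolve_right hψ
        exact hχ ⟨fun i => c (some i), fun x z => by rw [hc, h0, zero_mul, zero_add]⟩)
    exact ⟨a, b, fun i => h1 (some i), h2, h3.comp some (Option.some_injective _)⟩

theorem exists_regular_pair [FiniteDimensional ℝ W] {ι : Type*} [Fintype ι]
    {φ : ι → Dual ℝ W} {χ : Dual ℝ W}
    {p : W × W} (hpp : LinearIndependent ℝ ![p.1, p.2])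
    (hp : LinearIndependent ℝ fun i => area (φ i) p)
    (hχ : ¬ ∃ c : ι → ℝ, ∀ x y : W, χ x * χ y = ∑ i, c i * (φ i x * φ i y)) :
    ∃ x y : W × W, (∀ i, sqLen (φ i) x = sqLen (φ i) y) ∧ sqLen χ x ≠ sqLen χ y ∧
      LinearIndependent ℝ fun i => area (φ i) y := by
  classical
  have hp0 : p ≠ 0 := by
    rintro rfl
    exact hpp.ne_zero 0 rfl
  have h1 := finrank_ker_add_card hp
  have h2 : Submodule.span ℝ {p} ≤ LinearMap.ker (LinearMap.pi fun i => area (φ i) p) := by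
    rw [Submodule.span_singleton_le_iff_mem, LinearMap.mem_ker]
    ext l
    simp only [LinearMap.pi_apply, area_apply, Pi.zero_apply]
    ring
  have h3 := Submodule.finrank_mono h2
  rw [finrank_span_singleton hp0] at h3
  rw [finrank_prod] at h1
  exact exists_pair_of_le (2 * finrank ℝ W - (Fintype.card ι + 1)) (by omega) hpp hp hχ

end

theorem formallySmooth_of_charZero (K L : Type*) [Field K] [CharZero K] [Field L] [Algebra K L] :
    Algebra.FormallySmooth K L := by
  obtain ⟨s, hs⟩ := exists_isTranscendenceBasis K L
  have : Algebra.IsAlgebraic (IntermediateField.adjoin K (Set.range ((↑) : s → L))) L :=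
    hs.isAlgebraic_field
  exact .of_algebraicIndependent_of_isSeparable hs.1

theorem exists_ringHom_lift {A L B : Type*} [CommRing A] [Field L] [CharZero L] [CommRing B]
    {i : A →+* L} (hi : Function.Injective i) {θ : A →+* B} {g : B →+* L}
    (hg : Function.Surjective g) (hnil : IsNilpotent (RingHom.ker g)) (hgθ : g.comp θ = i) :
    ∃ s : L →+* B, g.comp s = RingHom.id L ∧ s.comp i = θ := by
  let : Algebra A L := i.toAlgebra
  let : Algebra A B := θ.toAlgebra
  have : IsDomain A := hi.isDomain i
  have : FaithfulSMul A L := (faithfulSMul_iff_algebraMap_injective A L).2 hi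
  let K := FractionRing A
  let : Algebra K L := FractionRing.liftAlgebra A L
  have : IsScalarTower A K L := FractionRing.isScalarTower_liftAlgebra A L
  have : CharZero K := (algebraMap K L).charZero
  have : Algebra.FormallySmooth K L := formallySmooth_of_charZero K L
  have : Algebra.FormallySmooth A K := Algebra.FormallySmooth.of_isLocalization (nonZeroDivisors A)
  have : Algebra.FormallySmooth A L := Algebra.FormallySmooth.comp A K L
  let g' : B →ₐ[A] L := { g with commutes' := fun a => RingHom.congr_fun hgθ a }
  let s := Algebra.FormallySmooth.liftOfSurjective (AlgHom.id A L) g' hg hnil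
  have hs : ∀ x, g' (s x) = x := fun x =>
    Algebra.FormallySmooth.liftOfSurjective_apply (AlgHom.id A L) g' hg hnil x
  exact ⟨s.toRingHom, RingHom.ext hs, RingHom.ext fun a => s.commutes a⟩

open TrivSqZeroExt in
theorem exists_derivation {A L : Type*} [CommRing A] [Field L] [CharZero L]
    {i : A →+* L} (hi : Function.Injective i) {θ : A →+* TrivSqZeroExt L L}
    (hθ : ∀ a, fst (θ a) = i a) :
    ∃ D : Derivation ℚ L L, ∀ a, D (i a) = snd (θ a) := by
  let g : TrivSqZeroExt L L →+* L := (fstHom ℚ L L).toRingHom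
  have hg : Function.Surjective g := fun x => ⟨inl x, fst_inl L x⟩
  have hnil : IsNilpotent (RingHom.ker g) := by
    refine ⟨2, (pow_two (RingHom.ker g)).trans (le_bot_iff.1 (Ideal.mul_le.2 ?_))⟩
    intro x hx y hy
    have hx' : fst x = 0 := hx
    have hy' : fst y = 0 := hy
    rw [Ideal.mem_bot]
    ext <;> simp [hx', hy']
  obtain ⟨s, hs, hsθ⟩ := exists_ringHom_lift hi hg hnil (RingHom.ext hθ)
  have hs' : ∀ x, fst (s x) = x := fun x => RingHom.congr_fun hs x
  let d : L →+ L := (sndHom L L).toAddMonoidHom.comp s.toAddMonoidHom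
  have hd : ∀ x, d x = snd (s x) := fun x => rfl
  refine ⟨Derivation.mk' d.toRatLinearMap fun a b => ?_, fun a => ?_⟩
  · change d (a * b) = a • d b + b • d a
    rw [hd, hd, hd, map_mul, snd_mul, hs', hs']
    simp [mul_comm]
  · change snd (s (i a)) = _
    rw [← hsθ]
    rfl

theorem exists_derivation_of_algebraicIndependent {σ L : Type*} [Field L] [CharZero L] {p : σ → L}
    (hp : AlgebraicIndependent ℚ p) (v : σ → L) : ∃ D : Derivation ℚ L L, ∀ s, D (p s) = v s := by
  let θ : MvPolynomial σ ℚ →ₐ[ℚ] TrivSqZeroExt L L :=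
    MvPolynomial.aeval fun s => TrivSqZeroExt.inl (p s) + TrivSqZeroExt.inr (v s)
  obtain ⟨D, hD⟩ := exists_derivation (i := (MvPolynomial.aeval p).toRingHom) (θ := θ.toRingHom)
    (algebraicIndependent_iff_injective_aeval.1 hp)
    (fun a => by
      have : (TrivSqZeroExt.fstHom ℚ L L).comp θ = MvPolynomial.aeval p := by
        ext s
        simp [θ]
      exact DFunLike.congr_fun this a)
  refine ⟨D, fun s => ?_⟩
  have := hD (MvPolynomial.X s)
  simpa [θ] using this

/-- The linear map sending weights `σ` to the weighted sum `∑ i, σ i • (φ i ⊗ φ i)`. -/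
def stressForm {W ι : Type*} [AddCommGroup W] [Module ℝ W] [Fintype ι] (φ : ι → Dual ℝ W) :
    (ι → ℝ) →ₗ[ℝ] W →ₗ[ℝ] Dual ℝ W :=
  ∑ i, (LinearMap.proj i).smulRight ((φ i).smulRight (φ i))

section stressForm

variable {W ι : Type*} [AddCommGroup W] [Module ℝ W] [Fintype ι] (φ : ι → Dual ℝ W)

theorem stressForm_apply (σ : ι → ℝ) (x y : W) :
    stressForm φ σ x y = ∑ i, σ i * (φ i x * φ i y) := by
  simp [stressForm, LinearMap.sum_apply]

theorem stressForm_comm (σ : ι → ℝ) (x y : W) : stressForm φ σ x y = stressForm φ σ y x := by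
  simp only [stressForm_apply, mul_comm (φ _ x)]

/-- The weights that are in equilibrium at every point `p j`. -/
def stressSpace {κ : Type*} (p : κ → W) : Submodule ℝ (ι → ℝ) where
  carrier := {σ | ∀ j, stressForm φ σ (p j) = 0}
  add_mem' ha hb j := by simp [ha j, hb j]
  zero_mem' j := by simp
  smul_mem' c a ha j := by simp [ha j]

/-- The vectors annihilated by every weight that is in equilibrium at the points `p j`. -/
def stressKernel {κ : Type*} (p : κ → W) : Submodule ℝ W where
  carrier := {x | ∀ σ ∈ stressSpace φ p, stressForm φ σ x = 0}
  add_mem' ha hb σ hσ := by simp [ha σ hσ, hb σ hσ]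
  zero_mem' σ hσ := by simp
  smul_mem' c a ha σ hσ := by simp [ha σ hσ]

theorem self_mem_stressKernel {κ : Type*} (p : κ → W) (j : κ) : p j ∈ stressKernel φ p :=
  fun _ hσ => hσ j

theorem mem_span_of_vanish_on_stressKernel [FiniteDimensional ℝ W] {κ : Type*} {p : κ → W}
    {f : Dual ℝ W} (hf : ∀ x ∈ stressKernel φ p, f x = 0) :
    f ∈ Submodule.span ℝ {g | ∃ σ ∈ stressSpace φ p, ∃ y, g = stressForm φ σ y} := by
  rw [← Subspace.dualCoannihilator_dualAnnihilator_eq (W := Submodule.span ℝ _),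
    Submodule.mem_dualAnnihilator]
  intro x hx
  refine hf x fun σ hσ => LinearMap.ext fun y => ?_
  rw [Submodule.mem_dualCoannihilator] at hx
  rw [stressForm_comm]
  exact hx _ (Submodule.subset_span ⟨σ, hσ, y, rfl⟩)

end stressForm

/-- The linear form `x ↦ x e.1 - x e.2` attached to a pair of vertices. -/
def edgeForm {V : Type*} (e : V × V) : Dual ℝ (V → ℝ) :=
  (LinearMap.proj e.1 : (V → ℝ) →ₗ[ℝ] ℝ) - LinearMap.proj e.2

@[simp]
theorem edgeForm_apply {V : Type*} (e : V × V) (x : V → ℝ) : edgeForm e x = x e.1 - x e.2 := rfl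

section derivation

variable {V ι : Type*} [Fintype ι] (e : ι → V × V)

theorem derivation_stressForm (D : Derivation ℚ ℝ ℝ) (σ : ι → ℝ) (x y : V → ℝ) :
    D (stressForm (fun i => edgeForm (e i)) σ x y) =
      stressForm (fun i => edgeForm (e i)) (D ∘ σ) x y +
      stressForm (fun i => edgeForm (e i)) σ (D ∘ x) y +
      stressForm (fun i => edgeForm (e i)) σ x (D ∘ y) := by
  simp only [stressForm_apply, map_sum, Derivation.leibniz, edgeForm_apply, map_sub, smul_eq_mul,
    Function.comp_apply, ← Finset.sum_add_distrib]
  exact Finset.sum_congr rfl fun i _ => by ring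

variable {κ : Type*} {p : κ → V → ℝ}

theorem exists_weight_of_mem_span [DecidableEq κ]
    (hp : AlgebraicIndependent ℚ fun s : V × κ => p s.2 s.1) (j : κ)
    {f : Dual ℝ (V → ℝ)} (hf : f ∈ Submodule.span ℝ {g | ∃ σ ∈ stressSpace
      (fun i => edgeForm (e i)) p, ∃ y, g = stressForm (fun i => edgeForm (e i)) σ y}) :
    ∃ τ, (∀ k, stressForm (fun i => edgeForm (e i)) τ (p k) = if k = j then f else 0) ∧
      ∀ x ∈ stressKernel (fun i => edgeForm (e i)) p,
        stressForm (fun i => edgeForm (e i)) τ x x = 0 := by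
  induction hf using Submodule.span_induction with
  | mem f hf =>
    obtain ⟨ω, hω, y, rfl⟩ := hf
    obtain ⟨D, hD⟩ := exists_derivation_of_algebraicIndependent hp
      fun s => if s.2 = j then y s.1 else 0
    refine ⟨-(D ∘ ω), fun k => LinearMap.ext fun z => ?_, fun x hx => ?_⟩
    · have h := derivation_stressForm e D ω (p k) z
      have hk : D ∘ p k = if k = j then y else 0 := by
        funext v
        have := hD (v, k)
        simp only at this
        rw [Function.comp_apply, this]
        split_ifs <;> rfl
      rw [hω k, LinearMap.zero_apply, LinearMap.zero_apply, map_zero, hk] at h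
      rw [map_neg, LinearMap.neg_apply, LinearMap.neg_apply]
      split_ifs with hkj
      · simp only [hkj, if_true] at h ⊢
        linarith
      · simp only [hkj, if_false, map_zero, LinearMap.zero_apply] at h ⊢
        linarith
    · have h := derivation_stressForm e D ω x x
      rw [stressForm_comm _ ω (D ∘ x) x, hx ω hω] at h
      simp only [LinearMap.zero_apply, map_zero] at h
      rw [map_neg, LinearMap.neg_apply, LinearMap.neg_apply]
      linarith
  | zero => exact ⟨0, by simp, by simp⟩
  | add f g _ _ hf hg =>
    obtain ⟨τ, h1, h2⟩ := hf
    obtain ⟨τ', h1', h2'⟩ := hg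
    refine ⟨τ + τ', fun k => ?_, fun x hx => ?_⟩
    · rw [map_add, LinearMap.add_apply, h1, h1']
      split_ifs <;> simp
    · rw [map_add, LinearMap.add_apply, LinearMap.add_apply, h2 x hx, h2' x hx, add_zero]
  | smul c f _ hf =>
    obtain ⟨τ, h1, h2⟩ := hf
    refine ⟨c • τ, fun k => ?_, fun x hx => ?_⟩
    · rw [map_smul, LinearMap.smul_apply, h1]
      split_ifs <;> simp
    · rw [map_smul, LinearMap.smul_apply, LinearMap.smul_apply, h2 x hx, smul_zero]

/-- At a generic placement, a weight whose equilibrium equations hold modulo functionals vanishing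
on the stress kernel induces the zero form on the stress kernel. -/
theorem stressForm_eq_zero_on_stressKernel [Finite V] [Finite κ]
    (hp : AlgebraicIndependent ℚ fun s : V × κ => p s.2 s.1) {σ : ι → ℝ}
    (hσ : ∀ j, ∀ x ∈ stressKernel (fun i => edgeForm (e i)) p,
      stressForm (fun i => edgeForm (e i)) σ (p j) x = 0)
    {x y : V → ℝ} (hx : x ∈ stressKernel (fun i => edgeForm (e i)) p)
    (hy : y ∈ stressKernel (fun i => edgeForm (e i)) p) :
    stressForm (fun i => edgeForm (e i)) σ x y = 0 := by
  classical
  have := Fintype.ofFinite κ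
  choose τ h1 h2 using fun j => exists_weight_of_mem_span e hp j
    (mem_span_of_vanish_on_stressKernel _ (hσ j))
  have hmem : σ - ∑ j, τ j ∈ stressSpace (fun i => edgeForm (e i)) p := fun k => by
    rw [map_sub, map_sum, LinearMap.sub_apply, LinearMap.sum_apply]
    simp [h1]
  have hdiag : ∀ z ∈ stressKernel (fun i => edgeForm (e i)) p,
      stressForm (fun i => edgeForm (e i)) σ z z = 0 := fun z hz => by
    have := LinearMap.congr_fun (hz _ hmem) z
    rw [map_sub, map_sum, LinearMap.sub_apply, LinearMap.sum_apply, LinearMap.sub_apply,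
      LinearMap.sum_apply, Finset.sum_eq_zero fun j _ => h2 j z hz] at this
    simpa using this
  have h := hdiag _ (add_mem hx hy)
  simp only [map_add, LinearMap.add_apply, hdiag x hx, hdiag y hy] at h
  rw [stressForm_comm _ σ y x] at h
  linarith

end derivation

section

variable {V ι κ : Type*} [Fintype κ] (e : ι → V × V) {p : κ → V → ℝ} {q : κ → V → ℂ}

open TrivSqZeroExt in
theorem exists_derivation_sqLength
    (hp : AlgebraicIndependent ℚ fun s : V × κ => p s.2 s.1)
    (hpq : ∀ i, ∑ k, (q k (e i).1 - q k (e i).2) ^ 2 =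
      ∑ k, ((p k (e i).1 : ℂ) - p k (e i).2) ^ 2) (v : κ → V → ℂ) :
    ∃ D : Derivation ℚ ℂ ℂ, ∀ i, D (∑ k, ((p k (e i).1 : ℂ) - p k (e i).2) ^ 2) =
      2 * ∑ k, (q k (e i).1 - q k (e i).2) * (v k (e i).1 - v k (e i).2) := by
  let ℓ : ι → MvPolynomial (V × κ) ℚ := fun i =>
    ∑ k, (MvPolynomial.X ((e i).1, k) - MvPolynomial.X ((e i).2, k)) ^ 2
  let B := Algebra.adjoin ℚ (Set.range ℓ)
  have hpC : AlgebraicIndependent ℚ fun s : V × κ => ((p s.2 s.1 : ℝ) : ℂ) :=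
    hp.map' (f := (Complex.ofRealAm.restrictScalars ℚ)) Complex.ofReal_injective
  let f : MvPolynomial (V × κ) ℚ →ₐ[ℚ] ℂ := MvPolynomial.aeval fun s => ((p s.2 s.1 : ℝ) : ℂ)
  let θ : MvPolynomial (V × κ) ℚ →ₐ[ℚ] TrivSqZeroExt ℂ ℂ :=
    MvPolynomial.aeval fun s => inl (q s.2 s.1) + inr (v s.2 s.1)
  have hfθ : B ≤ AlgHom.equalizer ((fstHom ℚ ℂ ℂ).comp θ) f := by
    refine Algebra.adjoin_le ?_
    rintro _ ⟨i, rfl⟩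
    rw [SetLike.mem_coe, AlgHom.mem_equalizer]
    simpa [ℓ, θ, f] using hpq i
  obtain ⟨D, hD⟩ := exists_derivation (i := (f.comp B.val).toRingHom)
    (θ := (θ.comp B.val).toRingHom)
    ((algebraicIndependent_iff_injective_aeval.1 hpC).comp Subtype.val_injective)
    fun a => hfθ a.2
  refine ⟨D, fun i => ?_⟩
  have h := hD ⟨ℓ i, Algebra.subset_adjoin ⟨i, rfl⟩⟩
  have h1 : f (ℓ i) = ∑ k, ((p k (e i).1 : ℂ) - p k (e i).2) ^ 2 := by simp [ℓ, f]
  have h2 : snd (θ (ℓ i)) =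
      2 * ∑ k, (q k (e i).1 - q k (e i).2) * (v k (e i).1 - v k (e i).2) := by
    simp only [ℓ, θ, map_sum, map_pow, map_sub, MvPolynomial.aeval_X, snd_sum, Finset.mul_sum]
    refine Finset.sum_congr rfl fun k _ => ?_
    simp [sq]
    ring
  rw [← h1, ← h2]
  exact h

variable [Fintype ι]

/-- A stress of a generic real placement `p` is a stress of every complex placement with the
same edge lengths. -/
theorem sum_stress_mul_eq_zero
    (hp : AlgebraicIndependent ℚ fun s : V × κ => p s.2 s.1)
    (hpq : ∀ i, ∑ k, (q k (e i).1 - q k (e i).2) ^ 2 =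
      ∑ k, ((p k (e i).1 : ℂ) - p k (e i).2) ^ 2) {ω : ι → ℝ}
    (hω : ω ∈ stressSpace (fun i => edgeForm (e i)) p) (k : κ) (y : V → ℂ) :
    ∑ i, (ω i : ℂ) * ((q k (e i).1 - q k (e i).2) * (y (e i).1 - y (e i).2)) = 0 := by
  classical
  have hpz (j : κ) (z : V → ℂ) :
      ∑ i, (ω i : ℂ) * (((p j (e i).1 : ℂ) - p j (e i).2) * (z (e i).1 - z (e i).2)) = 0 := by
    have hre := LinearMap.congr_fun (hω j) fun v => (z v).re
    have him := LinearMap.congr_fun (hω j) fun v => (z v).im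
    simp only [stressForm_apply, edgeForm_apply, LinearMap.zero_apply] at hre him
    apply Complex.ext
    · rw [Complex.re_sum, Complex.zero_re, ← hre]
      exact Finset.sum_congr rfl fun i _ => by simp
    · rw [Complex.im_sum, Complex.zero_im, ← him]
      exact Finset.sum_congr rfl fun i _ => by simp
  obtain ⟨D, hD⟩ := exists_derivation_sqLength e hp hpq (Pi.single k y)
  have h1 (i : ι) : D (∑ j, ((p j (e i).1 : ℂ) - p j (e i).2) ^ 2) =
      2 * ((q k (e i).1 - q k (e i).2) * (y (e i).1 - y (e i).2)) := by
    rw [hD, Finset.sum_eq_single k]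
    · simp
    · intro j _ hj
      simp [hj]
    · simp
  have h2 (i : ι) : D (∑ j, ((p j (e i).1 : ℂ) - p j (e i).2) ^ 2) =
      2 * ∑ j, ((p j (e i).1 : ℂ) - p j (e i).2) * (D (p j (e i).1) - D (p j (e i).2)) := by
    rw [map_sum, Finset.mul_sum]
    refine Finset.sum_congr rfl fun j _ => ?_
    rw [Derivation.leibniz_pow, map_sub]
    simp
  have h3 (i : ι) : (q k (e i).1 - q k (e i).2) * (y (e i).1 - y (e i).2) =
      ∑ j, ((p j (e i).1 : ℂ) - p j (e i).2) * (D (p j (e i).1) - D (p j (e i).2)) :=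
    mul_left_cancel₀ two_ne_zero ((h1 i).symm.trans (h2 i))
  simp only [h3, Finset.mul_sum]
  rw [Finset.sum_comm]
  exact Finset.sum_eq_zero fun j _ => hpz j fun v => D (p j v)

theorem re_mem_stressKernel
    (hp : AlgebraicIndependent ℚ fun s : V × κ => p s.2 s.1)
    (hpq : ∀ i, ∑ k, (q k (e i).1 - q k (e i).2) ^ 2 =
      ∑ k, ((p k (e i).1 : ℂ) - p k (e i).2) ^ 2) (k : κ) :
    (fun v => (q k v).re) ∈ stressKernel (fun i => edgeForm (e i)) p := fun ω hω =>
  LinearMap.ext fun y => by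
    have := congrArg Complex.re (sum_stress_mul_eq_zero e hp hpq hω k fun v => (y v : ℂ))
    rw [Complex.re_sum, Complex.zero_re] at this
    rw [stressForm_apply, LinearMap.zero_apply, ← this]
    exact Finset.sum_congr rfl fun i _ => by simp

theorem im_mem_stressKernel
    (hp : AlgebraicIndependent ℚ fun s : V × κ => p s.2 s.1)
    (hpq : ∀ i, ∑ k, (q k (e i).1 - q k (e i).2) ^ 2 =
      ∑ k, ((p k (e i).1 : ℂ) - p k (e i).2) ^ 2) (k : κ) :
    (fun v => (q k v).im) ∈ stressKernel (fun i => edgeForm (e i)) p := fun ω hω =>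
  LinearMap.ext fun y => by
    have := congrArg Complex.im (sum_stress_mul_eq_zero e hp hpq hω k fun v => (y v : ℂ))
    rw [Complex.im_sum, Complex.zero_im] at this
    rw [stressForm_apply, LinearMap.zero_apply, ← this]
    exact Finset.sum_congr rfl fun i _ => by simp

end

theorem countable_mvPolynomial {σ : Type*} [Countable σ] : Countable (MvPolynomial σ ℚ) := by
  rw [← Cardinal.mk_le_aleph0_iff]
  simp

theorem exists_algebraicIndependent_real (σ : Type*) [Finite σ] :
    ∃ p : σ → ℝ, AlgebraicIndependent ℚ p := by
  obtain ⟨s, hs⟩ := exists_isTranscendenceBasis ℚ ℝ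
  have hinf : Infinite s := by
    by_contra h
    rw [not_infinite_iff_finite] at h
    have : Countable (MvPolynomial s ℚ) := countable_mvPolynomial
    have : Countable (Algebra.adjoin ℚ (Set.range ((↑) : s → ℝ))) :=
      hs.1.aevalEquiv.symm.injective.countable
    have : Algebra.IsAlgebraic (Algebra.adjoin ℚ (Set.range ((↑) : s → ℝ))) ℝ := hs.isAlgebraic
    have hle := Algebra.IsAlgebraic.cardinalMk_le_max (Algebra.adjoin ℚ (Set.range ((↑) : s → ℝ))) ℝ
    rw [Cardinal.mk_real, max_eq_right Cardinal.mk_le_aleph0] at hle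
    exact absurd hle (not_le.2 Cardinal.aleph0_lt_continuum)
  have := Fintype.ofFinite σ
  obtain ⟨f, hf⟩ : ∃ f : σ → s, Function.Injective f :=
    ⟨_, ((Fintype.equivFin σ).toEmbedding.trans (Fin.valEmbedding.trans
      (Infinite.natEmbedding s))).injective⟩
  exact ⟨_, hs.1.comp f hf⟩

open Polynomial in
theorem frequently_algebraicIndependent_lineMap {σ : Type*} [Countable σ] {p : σ → ℝ}
    (hp : AlgebraicIndependent ℚ p) (a : σ → ℝ) :
    ∃ᶠ t in 𝓝 (0 : ℝ), AlgebraicIndependent ℚ fun s => a s + t * (p s - a s) := by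
  let P : MvPolynomial σ ℚ →ₐ[ℚ] ℝ[X] :=
    MvPolynomial.aeval fun s => C (a s) + X * C (p s - a s)
  have hP (t : ℝ) (F : MvPolynomial σ ℚ) :
      (P F).eval t = MvPolynomial.aeval (fun s => a s + t * (p s - a s)) F := by
    have : ((aeval t).restrictScalars ℚ).comp P =
        MvPolynomial.aeval (fun s => a s + t * (p s - a s)) := by
      ext s
      simp [P]
    rw [← this]
    simp
  have hP0 (F : MvPolynomial σ ℚ) (hF : F ≠ 0) : P F ≠ 0 := fun h => by
    have h1 := hP 1 F
    rw [h, eval_zero] at h1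
    refine hF (hp.eq_zero_of_aeval_eq_zero F ?_)
    rw [h1]
    congr 2
    funext s
    ring
  have : Countable (MvPolynomial σ ℚ) := countable_mvPolynomial
  have hcount : (⋃ F : {F : MvPolynomial σ ℚ // F ≠ 0}, (P F).rootSet ℝ).Countable :=
    Set.countable_iUnion fun F => (rootSet_finite _ _).countable
  refine (mem_closure_iff_frequently.1 (hcount.dense_compl ℝ 0)).mono fun t ht => ?_
  rw [algebraicIndependent_iff]
  intro F hF
  by_contra hF0
  refine ht (Set.mem_iUnion.2 ⟨⟨F, hF0⟩, ?_⟩)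
  rw [mem_rootSet]
  refine ⟨hP0 F hF0, ?_⟩
  simpa [aeval_def, hP] using hF

theorem exists_ringHom_extend {k A L : Type*} [Field k] [CommRing A] [Nontrivial A] [Algebra k A]
    [Algebra.FiniteType k A] [Field L] [IsAlgClosed L] (j : k →+* L) :
    ∃ g : A →+* L, g.comp (algebraMap k A) = j := by
  obtain ⟨m, hm⟩ := Ideal.exists_maximal A
  let _ : Field (A ⧸ m) := Ideal.Quotient.field m
  have : Algebra.FiniteType k (A ⧸ m) :=
    Algebra.FiniteType.of_surjective (Ideal.Quotient.mkₐ k m) (Ideal.Quotient.mkₐ_surjective k m)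
  have : Module.Finite k (A ⧸ m) := finite_of_finite_type_of_isJacobsonRing k (A ⧸ m)
  let _ : Algebra k L := j.toAlgebra
  let f : (A ⧸ m) →ₐ[k] L := IsAlgClosed.lift
  exact ⟨(f.comp (Ideal.Quotient.mkₐ k m)).toRingHom,
    RingHom.ext fun x => (f.comp (Ideal.Quotient.mkₐ k m)).commutes x⟩

/-- A finite amount of algebraic data over one generic point can be specialised to any other
generic point. -/
theorem exists_specialization {σ L : Type*} [Field L] [CharZero L] [IsAlgClosed L] {p p' : σ → L}
    (hp : AlgebraicIndependent ℚ p) (hp' : AlgebraicIndependent ℚ p') {S : Set L} (hS : S.Finite) :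
    ∃ (A : Subring L) (g : A →+* L), S ⊆ A ∧ ∀ s, ∃ h : p s ∈ A, g ⟨p s, h⟩ = p' s := by
  let k := FractionRing (MvPolynomial σ ℚ)
  let i : k →+* L :=
    IsFractionRing.lift (g := (MvPolynomial.aeval p : MvPolynomial σ ℚ →ₐ[ℚ] L).toRingHom)
    (algebraicIndependent_iff_injective_aeval.1 hp)
  let j : k →+* L :=
    IsFractionRing.lift (g := (MvPolynomial.aeval p' : MvPolynomial σ ℚ →ₐ[ℚ] L).toRingHom)
    (algebraicIndependent_iff_injective_aeval.1 hp')
  have hi (s : σ) : i (algebraMap (MvPolynomial σ ℚ) k (MvPolynomial.X s)) = p s := by simp [i, k]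
  have hj (s : σ) : j (algebraMap (MvPolynomial σ ℚ) k (MvPolynomial.X s)) = p' s := by simp [j, k]
  let _ : Algebra k L := i.toAlgebra
  let A := Algebra.adjoin k S
  have : Algebra.FiniteType k A := A.fg_iff_finiteType.1 ⟨hS.toFinset, by simp [A]⟩
  obtain ⟨g, hg⟩ := exists_ringHom_extend (A := A) j
  refine ⟨A.toSubring, g, Algebra.subset_adjoin, fun s => ?_⟩
  have hs : p s ∈ A := hi s ▸ A.algebraMap_mem (algebraMap (MvPolynomial σ ℚ) k (MvPolynomial.X s))
  refine ⟨hs, ?_⟩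
  rw [← hj, ← hg]
  exact congrArg g (a₂ := algebraMap k A (algebraMap (MvPolynomial σ ℚ) k (MvPolynomial.X s)))
    (Subtype.ext (hi s).symm)

theorem stressForm_sum_single {W ι : Type*} [AddCommGroup W] [Module ℝ W] [Fintype ι]
    {φ : ι → Dual ℝ W} [DecidableEq ι] {κ : Type*} [Fintype κ] (a : κ → ι) (c : κ → ℝ)
    (x y : W) : stressForm φ (∑ k, Pi.single (a k) (c k)) x y =
      ∑ k, c k * (φ (a k) x * φ (a k) y) := by
  rw [map_sum, LinearMap.sum_apply, LinearMap.sum_apply]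
  refine Finset.sum_congr rfl fun k _ => ?_
  rw [stressForm_apply, Finset.sum_eq_single (a k)]
  · simp
  · intro i _ hi
    simp [hi]
  · simp

section

variable {W ι : Type*} [NormedAddCommGroup W] [NormedSpace ℝ W] [FiniteDimensional ℝ W]
  {χ : Dual ℝ W} {x y : W × W}

theorem hasStrictFDerivAt_sqLen (f : Dual ℝ W) (y : W × W) :
    HasStrictFDerivAt (sqLen f)
      (LinearMap.toContinuousLinearMap ((2 : ℝ) • (area f y ∘ₗ quarterTurn))) y := by
  let g := LinearMap.toContinuousLinearMap f
  have h1 : HasStrictFDerivAt (fun z : W × W => f z.1) (g.comp (.fst ℝ W W)) y :=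
    g.hasStrictFDerivAt.comp y hasStrictFDerivAt_fst
  have h2 : HasStrictFDerivAt (fun z : W × W => f z.2) (g.comp (.snd ℝ W W)) y :=
    g.hasStrictFDerivAt.comp y hasStrictFDerivAt_snd
  refine ((h1.pow 2).add (h2.pow 2)).congr_fderiv ?_
  ext z <;> simp [g] <;> ring

theorem continuous_sqLen (f : Dual ℝ W) : Continuous (sqLen f) :=
  continuous_iff_continuousAt.2 fun y => (hasStrictFDerivAt_sqLen f y).continuousAt

variable [Fintype ι] {φ : ι → Dual ℝ W}

/-- Near a pair that is regular on the second side, prescribed lengths can be continued. -/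
theorem eventually_exists_sqLen_eq (h : ∀ i, sqLen (φ i) x = sqLen (φ i) y)
    (hχ : sqLen χ x ≠ sqLen χ y) (hy : LinearIndependent ℝ fun i => area (φ i) y) :
    ∀ᶠ x' in 𝓝 x, ∃ y', (∀ i, sqLen (φ i) x' = sqLen (φ i) y') ∧ sqLen χ x' ≠ sqLen χ y' := by
  classical
  let F : W × W → ι → ℝ := fun z i => sqLen (φ i) z
  have hF : HasStrictFDerivAt F (ContinuousLinearMap.pi fun i =>
      LinearMap.toContinuousLinearMap ((2 : ℝ) • (area (φ i) y ∘ₗ quarterTurn))) y :=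
    hasStrictFDerivAt_pi.2 fun i => hasStrictFDerivAt_sqLen (φ i) y
  have hmap : map F (𝓝 y) = 𝓝 (F x) := by
    rw [show F x = F y from funext h]
    refine hF.map_nhds_eq_of_surj (LinearMap.range_eq_top.2 fun b => ?_)
    obtain ⟨z, hz⟩ := pi_surjective_of_linearIndependent hy ((2 : ℝ)⁻¹ • b)
    refine ⟨(z.2, -z.1), funext fun i => ?_⟩
    have hzi := congrFun hz i
    simp only [LinearMap.pi_apply, area_apply, Pi.smul_apply, smul_eq_mul] at hzi
    simp
    linarith
  have hne : ∀ᶠ z in 𝓝 x ×ˢ 𝓝 y, sqLen χ z.1 ≠ sqLen χ z.2 := by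
    rw [← nhds_prod_eq]
    exact (isOpen_ne_fun ((continuous_sqLen χ).comp continuous_fst)
      ((continuous_sqLen χ).comp continuous_snd)).mem_nhds (x := (x, y)) hχ
  obtain ⟨P, hP, N, hN, hPN⟩ := eventually_prod_iff.1 hne
  have hFx : ContinuousAt F x :=
    continuousAt_pi.2 fun i => (continuous_sqLen (φ i)).continuousAt
  have him : F '' {z | N z} ∈ 𝓝 (F x) := hmap ▸ image_mem_map hN
  filter_upwards [hP, hFx him] with x' hx' hx''
  obtain ⟨y', hy', hxy⟩ := hx''
  exact ⟨y', fun i => (congrFun hxy i).symm, hPN hx' hy'⟩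

/-- If the square of `χ` is not a combination of the squares of the `φ i`, and equilibrium weights
at `p` induce the zero form, then some open set of pairs has companions with the same `φ`-lengths
and a different `χ`-length. -/
theorem exists_eventually_exists_sqLen_eq {p : W × W} (hpp : LinearIndependent ℝ ![p.1, p.2])
    (hp : ∀ σ, stressForm φ σ p.1 = 0 → stressForm φ σ p.2 = 0 → stressForm φ σ = 0)
    (hχ : ¬ ∃ c : ι → ℝ, ∀ x y : W, χ x * χ y = ∑ i, c i * (φ i x * φ i y)) :
    ∃ x : W × W, ∀ᶠ x' in 𝓝 x, ∃ y', (∀ i, sqLen (φ i) x' = sqLen (φ i) y') ∧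
      sqLen χ x' ≠ sqLen χ y' := by
  classical
  let t : ι → W × W → ℝ := fun i z => φ i z.1 * φ i z.2
  obtain ⟨κ, a, ha, hspan, hli⟩ := exists_linearIndependent' ℝ t
  have : Fintype κ := Fintype.ofInjective a ha
  have harea : LinearIndependent ℝ fun k => area (φ (a k)) p := by
    rw [Fintype.linearIndependent_iff] at hli ⊢
    intro σ hσ
    refine hli σ (funext fun z => ?_)
    have hσ' := hp (∑ k, Pi.single (a k) (σ k)) (LinearMap.ext fun z => ?_)
      (LinearMap.ext fun z => ?_)
    · have := LinearMap.congr_fun (LinearMap.congr_fun hσ' z.1) z.2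
      rw [stressForm_sum_single] at this
      simpa [t] using this
    · have := LinearMap.congr_fun hσ (0, z)
      rw [stressForm_sum_single]
      simpa [LinearMap.sum_apply] using this
    · have := LinearMap.congr_fun hσ (-z, 0)
      rw [stressForm_sum_single]
      simpa [LinearMap.sum_apply] using this
  obtain ⟨x, y, h1, h2, h3⟩ := exists_regular_pair (χ := χ) hpp harea fun ⟨c, hc⟩ =>
    hχ ⟨∑ k, Pi.single (a k) (c k), fun z w => by
      rw [hc, ← stressForm_sum_single, stressForm_apply]⟩
  refine ⟨x, (eventually_exists_sqLen_eq h1 h2 h3).mono fun x' ⟨y', hy', hne⟩ =>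
    ⟨y', fun i => ?_, hne⟩⟩
  let T : (W × W → ℝ) →ₗ[ℝ] ℝ :=
    (LinearMap.proj (x'.1, x'.1) : (W × W → ℝ) →ₗ[ℝ] ℝ) + LinearMap.proj (x'.2, x'.2)
  let T' : (W × W → ℝ) →ₗ[ℝ] ℝ :=
    (LinearMap.proj (y'.1, y'.1) : (W × W → ℝ) →ₗ[ℝ] ℝ) + LinearMap.proj (y'.2, y'.2)
  have hT : Set.EqOn T T' (Submodule.span ℝ (Set.range (t ∘ a))) := by
    refine LinearMap.eqOn_span' ?_
    rintro _ ⟨k, rfl⟩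
    simpa [T, T', t, sqLen, sq] using hy' k
  have := hT (hspan ▸ Submodule.subset_span ⟨i, rfl⟩ : t i ∈ Submodule.span ℝ (Set.range (t ∘ a)))
  simpa [T, T', t, sqLen, sq] using this

end

section

variable {V ι : Type*} [Fintype V] [Fintype ι] (e : ι → V × V) {p : Fin 2 → V → ℝ} {u v : V}

omit [Fintype V] in
theorem linearIndependent_pair_of_algebraicIndependent
    (hp : AlgebraicIndependent ℚ fun s : V × Fin 2 => p s.2 s.1) (huv : u ≠ v) :
    LinearIndependent ℝ ![p 0, p 1] := by
  classical
  let F : MvPolynomial (V × Fin 2) ℚ := .X (u, 0) * .X (v, 1) - .X (v, 0) * .X (u, 1)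
  have hF : F ≠ 0 := fun h => by
    have := congrArg (MvPolynomial.eval fun s => if s = (u, 0) ∨ s = (v, 1) then (1 : ℚ) else 0) h
    simp [F, huv, huv.symm] at this
  have hdet : p 0 u * p 1 v - p 0 v * p 1 u ≠ 0 := fun h => by
    refine hF (hp.eq_zero_of_aeval_eq_zero F ?_)
    simpa [F] using h
  rw [LinearIndependent.pair_iff]
  intro a b hab
  have h1 := congrFun hab u
  have h2 := congrFun hab v
  simp only [Pi.add_apply, Pi.smul_apply, smul_eq_mul, Pi.zero_apply] at h1 h2
  constructor
  · refine (mul_eq_zero.1 (?_ : a * (p 0 u * p 1 v - p 0 v * p 1 u) = 0)).resolve_right hdet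
    linear_combination p 1 v * h1 - p 1 u * h2
  · refine (mul_eq_zero.1 (?_ : b * (p 0 u * p 1 v - p 0 v * p 1 u) = 0)).resolve_right hdet
    linear_combination p 0 u * h2 - p 0 v * h1

/-- If the length of `uv` is determined by the lengths of the `e i` at all generic placements, then
on the stress kernel of a generic placement its square is a combination of theirs. -/
theorem exists_edgeForm_mul_eq_sum
    (hp : AlgebraicIndependent ℚ fun s : V × Fin 2 => p s.2 s.1) (huv : u ≠ v)
    (hlink : ∀ p' q' : Fin 2 → V → ℝ, AlgebraicIndependent ℚ (fun s : V × Fin 2 => p' s.2 s.1) →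
      (∀ i, ∑ k, edgeForm (e i) (p' k) ^ 2 = ∑ k, edgeForm (e i) (q' k) ^ 2) →
      ∑ k, edgeForm (u, v) (p' k) ^ 2 = ∑ k, edgeForm (u, v) (q' k) ^ 2) :
    ∃ c : ι → ℝ, ∀ x ∈ stressKernel (fun i => edgeForm (e i)) p,
      ∀ y ∈ stressKernel (fun i => edgeForm (e i)) p,
        edgeForm (u, v) x * edgeForm (u, v) y =
          ∑ i, c i * (edgeForm (e i) x * edgeForm (e i) y) := by
  let K := stressKernel (fun i => edgeForm (e i)) p
  let φ : ι → Dual ℝ K := fun i => edgeForm (e i) ∘ₗ K.subtype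
  let χ : Dual ℝ K := edgeForm (u, v) ∘ₗ K.subtype
  let P : K × K := (⟨p 0, self_mem_stressKernel _ p 0⟩, ⟨p 1, self_mem_stressKernel _ p 1⟩)
  by_contra hc
  have hPP : LinearIndependent ℝ ![P.1, P.2] := by
    refine LinearIndependent.of_comp K.subtype ?_
    have : K.subtype ∘ ![P.1, P.2] = ![p 0, p 1] := by
      ext k
      fin_cases k <;> rfl
    exact this ▸ linearIndependent_pair_of_algebraicIndependent hp huv
  have hφ (σ : ι → ℝ) (x y : K) :
      stressForm φ σ x y = stressForm (fun i => edgeForm (e i)) σ x y := by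
    simp [stressForm_apply, φ]
  have hP : ∀ σ, stressForm φ σ P.1 = 0 → stressForm φ σ P.2 = 0 → stressForm φ σ = 0 := by
    intro σ h1 h2
    refine LinearMap.ext fun x => LinearMap.ext fun y => ?_
    rw [hφ]
    refine stressForm_eq_zero_on_stressKernel e hp (fun j z hz => ?_) x.2 y.2
    fin_cases j
    · exact (hφ σ P.1 ⟨z, hz⟩).symm.trans (LinearMap.congr_fun h1 ⟨z, hz⟩)
    · exact (hφ σ P.2 ⟨z, hz⟩).symm.trans (LinearMap.congr_fun h2 ⟨z, hz⟩)
  obtain ⟨x, hx⟩ := exists_eventually_exists_sqLen_eq (χ := χ) hPP hP fun ⟨c, h⟩ =>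
    hc ⟨c, fun x hx y hy => h ⟨x, hx⟩ ⟨y, hy⟩⟩
  have hcont : Tendsto (fun t : ℝ => x + t • (P - x)) (𝓝 0) (𝓝 x) := by
    have : Continuous fun t : ℝ => x + t • (P - x) := by fun_prop
    simpa using this.tendsto 0
  let a : Fin 2 → K := ![x.1, x.2]
  obtain ⟨t, ht, y, hy, hne⟩ := ((frequently_algebraicIndependent_lineMap hp
    fun s => (a s.2 : V → ℝ) s.1).and_eventually (hcont hx)).exists
  let z := x + t • (P - x)
  have hsum (f : Dual ℝ (V → ℝ)) (w : K × K) :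
      ∑ k, f (![(w.1 : V → ℝ), w.2] k) ^ 2 = sqLen (f ∘ₗ K.subtype) w := by
    simp [sqLen, Fin.sum_univ_two]
  refine hne ?_
  rw [← hsum, ← hsum]
  refine hlink ![z.1, z.2] ![y.1, y.2] ?_ fun i => ?_
  · convert ht using 2 with s
    obtain ⟨w, k⟩ := s
    fin_cases k <;> simp [z, a, P]
  · rw [hsum, hsum]
    exact hy i

/-- Complex placements with the edge lengths of a generic real placement also share the length of
every pair whose length is determined at all generic real placements. -/
theorem complex_sqLength_eq
    (hp : AlgebraicIndependent ℚ fun s : V × Fin 2 => p s.2 s.1) (huv : u ≠ v)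
    (hlink : ∀ p' q' : Fin 2 → V → ℝ, AlgebraicIndependent ℚ (fun s : V × Fin 2 => p' s.2 s.1) →
      (∀ i, ∑ k, edgeForm (e i) (p' k) ^ 2 = ∑ k, edgeForm (e i) (q' k) ^ 2) →
      ∑ k, edgeForm (u, v) (p' k) ^ 2 = ∑ k, edgeForm (u, v) (q' k) ^ 2)
    {q : Fin 2 → V → ℂ} (hpq : ∀ i, ∑ k, (q k (e i).1 - q k (e i).2) ^ 2 =
      ∑ k, ((p k (e i).1 : ℂ) - p k (e i).2) ^ 2) :
    ∑ k, (q k u - q k v) ^ 2 = ∑ k, ((p k u : ℂ) - p k v) ^ 2 := by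
  obtain ⟨c, hc⟩ := exists_edgeForm_mul_eq_sum e hp huv hlink
  have key (z : V → ℂ) (hre : (fun w => (z w).re) ∈ stressKernel (fun i => edgeForm (e i)) p)
      (him : (fun w => (z w).im) ∈ stressKernel (fun i => edgeForm (e i)) p) :
      (z u - z v) ^ 2 = ∑ i, (c i : ℂ) * (z (e i).1 - z (e i).2) ^ 2 := by
    have h1 := hc _ hre _ hre
    have h2 := hc _ hre _ him
    have h3 := hc _ him _ him
    simp only [edgeForm_apply] at h1 h2 h3
    apply Complex.ext
    · rw [Complex.re_sum]
      simp only [sq, Complex.mul_re, Complex.mul_im, Complex.sub_re, Complex.sub_im,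
        Complex.ofReal_re, Complex.ofReal_im, zero_mul, sub_zero]
      rw [h1, h3, ← Finset.sum_sub_distrib]
      exact Finset.sum_congr rfl fun i _ => by ring
    · rw [Complex.im_sum]
      simp only [sq, Complex.mul_re, Complex.mul_im, Complex.sub_re, Complex.sub_im,
        Complex.ofReal_re, Complex.ofReal_im, zero_mul, add_zero]
      rw [mul_comm ((z u).im - (z v).im), h2, ← Finset.sum_add_distrib]
      exact Finset.sum_congr rfl fun i _ => by ring
  have hreal (k : Fin 2) := key (fun w => p k w)
    (by simpa using self_mem_stressKernel (fun i => edgeForm (e i)) p k)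
    (zero_mem (stressKernel (fun i => edgeForm (e i)) p))
  have hcomplex (k : Fin 2) := key (q k) (re_mem_stressKernel e hp hpq k)
    (im_mem_stressKernel e hp hpq k)
  simp only [hreal, hcomplex]
  rw [Finset.sum_comm, Finset.sum_comm (s := (Finset.univ : Finset (Fin 2)))]
  simp only [← Finset.mul_sum, hpq]

end

section

variable {V : Type*} {d : ℕ}

theorem eDist_eq_eDist_iff {x y z w : Fin d → ℝ} :
    eDist x y = eDist z w ↔ ∑ i, (x i - y i) ^ 2 = ∑ i, (z i - w i) ^ 2 :=
  Real.sqrt_inj (Finset.sum_nonneg fun _ _ => sq_nonneg _)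
    (Finset.sum_nonneg fun _ _ => sq_nonneg _)

theorem Generic.cGeneric_ofReal {p : V → Fin d → ℝ} (hp : Generic p) :
    CGeneric fun v k => (p v k : ℂ) :=
  hp.map' (f := Complex.ofRealAm.restrictScalars ℚ) Complex.ofReal_injective

theorem CGloballyLinked.globallyLinked {G : SimpleGraph V} {u v : V}
    (h : CGloballyLinked d G u v) : GloballyLinked d G u v := by
  intro p hp q hpq
  rw [eDist_eq_eDist_iff]
  have := h _ hp.cGeneric_ofReal (fun v k => (q v k : ℂ)) fun a b hab => by
    dsimp only
    exact_mod_cast eDist_eq_eDist_iff.1 (hpq a b hab)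
  exact_mod_cast this

/-- A violation of complex global linkedness can be moved to any generic complex placement. -/
theorem exists_cEquivalent_of_not_cGloballyLinked [Finite V] {G : SimpleGraph V} {u v : V}
    (h : ¬ CGloballyLinked d G u v) {p' : V → Fin d → ℂ} (hp' : CGeneric p') :
    ∃ q', CEquivalent G p' q' ∧ ∑ i, (q' u i - q' v i) ^ 2 ≠ ∑ i, (p' u i - p' v i) ^ 2 := by
  unfold CGloballyLinked at h
  push Not at h
  obtain ⟨p, hp, q, hpq, hne⟩ := h
  let δ := (∑ i, (q u i - q v i) ^ 2) - ∑ i, (p u i - p v i) ^ 2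
  have hδ : δ ≠ 0 := sub_ne_zero.2 hne
  obtain ⟨A, g, hS, hg⟩ := exists_specialization hp hp'
    (S := insert δ⁻¹ (Set.range fun s : V × Fin d => q s.1 s.2)) ((Set.finite_range _).insert _)
  let P : V → Fin d → A := fun w i => ⟨p w i, (hg (w, i)).1⟩
  let Q : V → Fin d → A := fun w i => ⟨q w i, hS (Or.inr ⟨(w, i), rfl⟩)⟩
  have hgP (w : V) (i : Fin d) : g (P w i) = p' w i := (hg (w, i)).2
  refine ⟨fun w i => g (Q w i), fun a b hab => ?_, fun heq => ?_⟩
  · have h1 : ∑ i, (P a i - P b i) ^ 2 = ∑ i, (Q a i - Q b i) ^ 2 := by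
      apply Subtype.ext
      push_cast
      exact hpq a b hab
    have := congrArg g h1
    simpa only [map_sum, map_pow, map_sub, hgP] using this
  · have h1 : ((∑ i, (Q u i - Q v i) ^ 2) - ∑ i, (P u i - P v i) ^ 2) *
        ⟨δ⁻¹, hS (Or.inl rfl)⟩ = 1 := by
      apply Subtype.ext
      push_cast
      exact mul_inv_cancel₀ hδ
    have := congrArg g h1
    simp only [map_mul, map_sum, map_pow, map_sub, hgP, heq, sub_self, zero_mul, map_one,
      zero_ne_one] at this

theorem GloballyLinked.cGloballyLinked [Finite V] {G : SimpleGraph V} {u v : V}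
    (h : GloballyLinked 2 G u v) : CGloballyLinked 2 G u v := by
  classical
  have := Fintype.ofFinite V
  by_contra hC
  have huv : u ≠ v := by
    rintro rfl
    exact hC fun p _ q _ => by simp
  obtain ⟨p, hp⟩ := exists_algebraicIndependent_real (V × Fin 2)
  obtain ⟨q, hpq, hne⟩ := exists_cEquivalent_of_not_cGloballyLinked hC
    (Generic.cGeneric_ofReal (p := fun w i => p (w, i)) hp)
  refine hne (complex_sqLength_eq (fun e : {e : V × V // G.Adj e.1 e.2} => e.1)
    (p := fun k w => p (w, k)) (q := fun k w => q w k) hp huv (fun p' q' hp' hlen => ?_)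
    fun e => (hpq _ _ e.2).symm)
  have := h (fun w k => p' k w) hp' (fun w k => q' k w) fun a b hab => by
    rw [eDist_eq_eDist_iff]
    exact hlen ⟨(a, b), hab⟩
  exact (eDist_eq_eDist_iff.1 this).symm

end

end

/-- `{u,v}` is globally linked in `G` in `ℝ²` iff it is globally linked in `G`
in `ℂ²`. -/
theorem globally_linked_real_iff_complex {V : Type*} [Fintype V] [DecidableEq V]
    (G : SimpleGraph V) (u v : V) :
    GloballyLinked 2 G u v ↔ CGloballyLinked 2 G u v := by
  exact ⟨GloballyLinked.cGloballyLinked, CGloballyLinked.globallyLinked⟩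

end Rigidity
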